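/- arXiv:2001.02490 — 6 statements merged into one kernel-verified Lean document; each statement's English description precedes it below -/
import Mathlib

section
/- Let G be a topological group, let p ≥ 2, and let ψ : G → ℝ≥0 be a continuous function such that ψ(g) = ‖α_g(0)‖_{L_2}^2 for some continuous affine isometric action α of G on an L_2 space. Then there exists a continuous affine isometric action β of G on an L_p space with ψ(g) = ‖β_g(0)‖_{L_p}^p for all g ∈ G. -/
open MeasureTheory ENNReal

/-- The quantity `‖f‖_p^p = ∫ |f|^p dμ`, valued in `ℝ≥0∞`.  This is the natural way to
measure the size of an element of an `L_p` space for any `0 < p < ∞`. -/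
noncomputable def pPow {X : Type*} [MeasurableSpace X] (μ : Measure X) (p : ℝ)
    (f : X →ₘ[μ] ℂ) : ℝ≥0∞ :=
  ∫⁻ x, (‖f x‖₊ : ℝ≥0∞) ^ p ∂μ

/-- A continuous affine isometric action of a topological group `G` on `L_p(X,μ)`:
a group homomorphism from `G` to the group of surjective affine isometries of
`L_p(X,μ)`, such that `g ↦ α_g f` is continuous for every `f`.  (Surjectivity of each
`act g` is automatic from the group laws.)  Isometry is expressed via the quantity
`pPow μ p` (i.e. `‖·‖_p^p`), and continuity via convergence in `L_p`, which makes sense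
for every `0 < p < ∞`, including `p < 1`. -/
structure AffineIsometricAction (G : Type*) [Group G] [TopologicalSpace G]
    {X : Type*} [MeasurableSpace X] (μ : Measure X) (p : ℝ) where
  act : G → Lp ℂ (ENNReal.ofReal p) μ → Lp ℂ (ENNReal.ofReal p) μ
  act_one : ∀ f, act 1 f = f
  act_mul : ∀ g h f, act (g * h) f = act g (act h f)
  isometry : ∀ g f f',
    pPow μ p ((act g f : X →ₘ[μ] ℂ) - (act g f' : X →ₘ[μ] ℂ))
      = pPow μ p ((f : X →ₘ[μ] ℂ) - (f' : X →ₘ[μ] ℂ))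
  affine : ∀ (g : G) (t : ℝ) (f f' : Lp ℂ (ENNReal.ofReal p) μ),
    act g (t • f + (1 - t) • f') = t • act g f + (1 - t) • act g f'
  continuous : ∀ (f : Lp ℂ (ENNReal.ofReal p) μ) (g₀ : G),
    Filter.Tendsto (fun g => pPow μ p ((act g f : X →ₘ[μ] ℂ) - (act g₀ f : X →ₘ[μ] ℂ)))
      (nhds g₀) (nhds 0)


/-- Elementary bound: `|x^a - y^a| ≤ m^(a-1)` when `m ≤ x, y` and `|x-y| ≤ 1`. -/
lemma aux_rpow_le {a x y : ℝ} (ha0 : 0 ≤ a) (ha1 : a ≤ 1) (hx : 0 < x) (hxy : x ≤ y)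
    (h1 : y ≤ x + 1) : y ^ a - x ^ a ≤ x ^ (a - 1) := by
  have e : y = x * (1 + (y - x) / x) := by field_simp; ring
  have hs : 0 ≤ (y - x) / x := div_nonneg (by linarith) hx.le
  have h2 := rpow_one_add_le_one_add_mul_self (s := (y - x) / x) (by linarith) ha0 ha1
  have h3 : y ^ a = x ^ a * (1 + (y - x) / x) ^ a := by
    conv_lhs => rw [e]
    rw [Real.mul_rpow hx.le (by linarith)]
  have hxa : 0 < x ^ a := Real.rpow_pos_of_pos hx a
  rw [h3, Real.rpow_sub_one hx.ne']
  have h4 : a * ((y - x) / x) ≤ 1 / x := by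
    rw [← mul_div_assoc]
    apply div_le_div_of_nonneg_right _ hx.le
    nlinarith
  calc _ ≤ x ^ a * (1 + a * ((y - x) / x)) - x ^ a := by gcongr
    _ ≤ x ^ a * (1 + 1 / x) - x ^ a := by gcongr
    _ = _ := by ring

lemma aux_holder {a x y : ℝ} (ha0 : 0 ≤ a) (ha1 : a ≤ 1) (hx : 0 ≤ x) (hy : 0 ≤ y)
    (h1 : y ≤ x + 1) : y ^ a - x ^ a ≤ 1 := by
  have h : y ^ a ≤ (x + 1) ^ a := Real.rpow_le_rpow hy h1 ha0
  have h2 := Real.rpow_add_le_add_rpow hx zero_le_one ha0 ha1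
  rw [Real.one_rpow] at h2
  linarith

lemma aux_bound {p : ℝ} (hp : 2 < p) (s : ℝ) :
    |(|s + 1| ^ (1 / p) - |s| ^ (1 / p))| ^ p ≤ 3 ^ (p - 1) * (1 + ‖s‖) ^ (-(p - 1)) := by
  have hp0 : 0 < p := by linarith
  have ha0 : 0 ≤ 1 / p := by positivity
  have ha1 : 1 / p ≤ 1 := by rw [div_le_one hp0]; linarith
  have hd1 : |s + 1| ≤ |s| + 1 := by simpa using abs_add_le s 1
  have hd2 : |s| ≤ |s + 1| + 1 := by
    have := abs_sub (s + 1) 1; simp at this; linarith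
  rw [Real.norm_eq_abs]
  have hpos : 0 < 1 + |s| := by positivity
  have key : (3 : ℝ) ^ (p - 1) * (1 + |s|) ^ (-(p - 1)) = ((1 + |s|) / 3) ^ (-(p - 1)) := by
    rw [Real.div_rpow hpos.le (by norm_num), Real.rpow_neg (by norm_num : (0:ℝ) ≤ 3)]
    field_simp
  rw [key]
  by_cases hs : |s| ≤ 2
  · have : |(|s + 1| ^ (1 / p) - |s| ^ (1 / p))| ≤ 1 := by
      rw [abs_le]
      have h1 := aux_holder ha0 ha1 (abs_nonneg s) (abs_nonneg (s+1)) hd1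
      have h2 := aux_holder ha0 ha1 (abs_nonneg (s+1)) (abs_nonneg s) hd2
      constructor <;> linarith
    calc _ ≤ (1:ℝ) ^ p := Real.rpow_le_rpow (abs_nonneg _) this hp0.le
      _ = 1 := Real.one_rpow p
      _ ≤ _ := Real.one_le_rpow_of_pos_of_le_one_of_nonpos (by positivity) (by linarith) (by linarith)
  · push Not at hs
    set m := min |s| |s + 1| with hm
    have hm3 : (1 + |s|) / 3 ≤ m := by
      rw [hm]; apply le_min <;> linarith
    have hm0 : 0 < m := lt_of_lt_of_le (by positivity) hm3
    have : |(|s + 1| ^ (1 / p) - |s| ^ (1 / p))| ≤ m ^ (1 / p - 1) := by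
      rcases le_total |s| |s + 1| with h | h
      · rw [hm, min_eq_left h, abs_of_nonneg]
        · exact aux_rpow_le ha0 ha1 (by linarith) h hd1
        · have := Real.rpow_le_rpow (abs_nonneg _) h ha0
          linarith
      · rw [hm, min_eq_right h, abs_sub_comm, abs_of_nonneg]
        · exact aux_rpow_le ha0 ha1 (by linarith) h hd2
        · have := Real.rpow_le_rpow (abs_nonneg _) h ha0
          linarith
    calc _ ≤ (m ^ (1 / p - 1)) ^ p := Real.rpow_le_rpow (abs_nonneg _) this hp0.le
      _ = m ^ (-(p - 1)) := by
        rw [← Real.rpow_mul hm0.le]; congr 1; field_simp; ring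
      _ ≤ _ := Real.rpow_le_rpow_of_nonpos (by positivity) hm3 (by linarith)

/-- A function on the line whose `L_p` displacement is exactly quadratic. -/
lemma exists_theta {p : ℝ} (hp : 2 < p) : ∃ θ : ℝ → ℂ, Measurable θ ∧
    ∀ x y : ℝ, ∫⁻ s : ℝ, ‖θ (s + x) - θ (s + y)‖ₑ ^ p = ‖x - y‖ₑ ^ (2 : ℝ) := by
  have hp0 : 0 < p := by linarith
  set u : ℝ → ℝ := fun s => |s| ^ (1 / p) with hu
  have huc : Continuous u := by
    rw [hu]
    exact continuous_abs.rpow_const (fun _ => Or.inr (by positivity))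
  set C : ℝ≥0∞ := ∫⁻ s : ℝ, ‖u (s + 1) - u s‖ₑ ^ p with hC
  have hmeas : Measurable fun s : ℝ => ‖u (s + 1) - u s‖ₑ ^ p := by fun_prop
  have hCtop : C ≠ ∞ := by
    have hi := (integrable_one_add_norm (E := ℝ) (μ := volume) (r := p - 1)
      (by simp; linarith)).const_mul (3 ^ (p - 1))
    have hlt := hi.lintegral_lt_top
    refine ne_top_of_le_ne_top hlt.ne (lintegral_mono fun s => ?_)
    rw [Real.enorm_eq_ofReal_abs, ENNReal.ofReal_rpow_of_nonneg (abs_nonneg _) hp0.le]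
    exact ENNReal.ofReal_le_ofReal (aux_bound hp s)
  have hC0 : C ≠ 0 := by
    rw [hC, Ne, lintegral_eq_zero_iff hmeas]
    intro h
    have h' : (fun s : ℝ => u (s + 1) - u s) =ᵐ[volume] fun _ => 0 := by
      filter_upwards [h] with s hs
      simpa [hp0, hp0.le, hp0.not_gt] using hs
    have h2 := (Continuous.ae_eq_iff_eq (μ := volume) (by fun_prop) continuous_const).1 h'
    have h3 := congrFun h2 0
    have : (p⁻¹ : ℝ) ≠ 0 := by positivity
    simp [hu, Real.zero_rpow this] at h3
  have hscale : ∀ r : ℝ, ∫⁻ s : ℝ, ‖u (s + r) - u s‖ₑ ^ p = ‖r‖ₑ ^ (2 : ℝ) * C := by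
    intro r
    by_cases hr : r = 0
    · simp [hr, hp0]
    have hmr : Measurable fun s : ℝ => ‖u (s + r) - u s‖ₑ ^ p := by fun_prop
    rw [← Real.smul_map_volume_mul_left hr, lintegral_smul_measure,
      lintegral_map hmr (by fun_prop)]
    have : ∀ s : ℝ, ‖u (r * s + r) - u (r * s)‖ₑ ^ p = ‖r‖ₑ * ‖u (s + 1) - u s‖ₑ ^ p := by
      intro s
      have e1 : r * s + r = r * (s + 1) := by ring
      have : u (r * s + r) - u (r * s) = |r| ^ (1/p) * (u (s + 1) - u s) := by
        simp only [hu]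
        rw [e1, abs_mul, abs_mul, Real.mul_rpow (abs_nonneg _) (abs_nonneg _),
          Real.mul_rpow (abs_nonneg _) (abs_nonneg _)]
        ring
      rw [this, enorm_mul, ENNReal.mul_rpow_of_nonneg _ _ hp0.le]
      congr 1
      rw [Real.enorm_eq_ofReal (by positivity), ENNReal.ofReal_rpow_of_nonneg (by positivity) hp0.le,
        ← Real.rpow_mul (abs_nonneg _), Real.enorm_eq_ofReal_abs]
      congr 1
      rw [one_div, inv_mul_cancel₀ hp0.ne', Real.rpow_one]
    simp_rw [this]
    rw [lintegral_const_mul _ hmeas, ← hC, smul_eq_mul, ← mul_assoc, ← Real.enorm_eq_ofReal_abs]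
    congr 1
    rw [← sq]; norm_cast
  refine ⟨fun s => ((C.toReal⁻¹ ^ (1 / p) * u s : ℝ) : ℂ), by fun_prop, fun x y => ?_⟩
  have hCr : 0 < C.toReal := ENNReal.toReal_pos hC0 hCtop
  have : ∀ s : ℝ, ‖((C.toReal⁻¹ ^ (1 / p) * u (s + x) : ℝ) : ℂ)
      - ((C.toReal⁻¹ ^ (1 / p) * u (s + y) : ℝ) : ℂ)‖ₑ ^ p
      = C⁻¹ * ‖u (s + x) - u (s + y)‖ₑ ^ p := by
    intro s
    rw [← Complex.ofReal_sub, ← mul_sub]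
    have : ∀ r : ℝ, ‖(r : ℂ)‖ₑ = ‖r‖ₑ := fun r => by
      rw [← ofReal_norm, ← ofReal_norm, Complex.norm_real]
    rw [this, enorm_mul, ENNReal.mul_rpow_of_nonneg _ _ hp0.le]
    congr 1
    rw [Real.enorm_eq_ofReal (by positivity), ENNReal.ofReal_rpow_of_nonneg (by positivity) hp0.le,
        ← Real.rpow_mul (by positivity), one_div, inv_mul_cancel₀ hp0.ne', Real.rpow_one,
        ENNReal.ofReal_inv_of_pos hCr, ENNReal.ofReal_toReal hCtop]
  simp_rw [this]
  rw [lintegral_const_mul _ (by fun_prop)]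
  have h2 : ∫⁻ s : ℝ, ‖u (s + x) - u (s + y)‖ₑ ^ p = ∫⁻ s : ℝ, ‖u (s + (x - y)) - u s‖ₑ ^ p := by
    rw [← lintegral_add_right_eq_self (fun s => ‖u (s + (x - y)) - u s‖ₑ ^ p) y]
    congr with s
    rw [show s + y + (x - y) = s + x by ring]
  rw [h2, hscale, mul_comm, mul_assoc, ENNReal.mul_inv_cancel hC0 hCtop, mul_one]

section
open Filter Topology ProbabilityTheory

/-- Riesz / Brezis-Lieb type lemma. -/
lemma aux_riesz {Y : Type*} [MeasurableSpace Y] {ν : Measure Y} {p : ℝ} (hp : 1 ≤ p)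
    (F : ℕ → Y → ℂ) (f : Y → ℂ) (hF : ∀ n, AEStronglyMeasurable (F n) ν) (hf : AEStronglyMeasurable f ν)
    (hfin : ∫⁻ y, ‖f y‖ₑ ^ p ∂ν ≠ ∞)
    (hn : ∀ n, ∫⁻ y, ‖F n y‖ₑ ^ p ∂ν = ∫⁻ y, ‖f y‖ₑ ^ p ∂ν)
    (hlim : ∀ᵐ y ∂ν, Tendsto (fun n => F n y) atTop (𝓝 (f y))) :
    Tendsto (fun n => ∫⁻ y, ‖F n y - f y‖ₑ ^ p ∂ν) atTop (𝓝 0) := by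
  have hp0 : 0 < p := by linarith
  set I := ∫⁻ y, ‖f y‖ₑ ^ p ∂ν with hI
  set K : ℝ≥0∞ := 2 ^ (p - 1) with hK
  have hKtop : K ≠ ∞ := by
    rw [hK]; exact ENNReal.rpow_ne_top_of_nonneg (by linarith) (by simp)
  -- pointwise bound
  have hpt : ∀ n y, ‖F n y - f y‖ₑ ^ p ≤ K * (‖F n y‖ₑ ^ p + ‖f y‖ₑ ^ p) := fun n y =>
    (ENNReal.rpow_le_rpow (enorm_sub_le) hp0.le).trans (ENNReal.rpow_add_le_mul_rpow_add_rpow _ _ hp)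
  have mF : ∀ n, AEMeasurable (fun y => ‖F n y‖ₑ ^ p) ν := fun n => (hF n).enorm.pow_const p
  have mf : AEMeasurable (fun y => ‖f y‖ₑ ^ p) ν := hf.enorm.pow_const p
  have md : ∀ n, AEMeasurable (fun y => ‖F n y - f y‖ₑ ^ p) ν := fun n => ((hF n).sub hf).enorm.pow_const p
  have mG : ∀ n, AEMeasurable (fun y => K * (‖F n y‖ₑ ^ p + ‖f y‖ₑ ^ p)) ν := fun n =>
    ((mF n).add mf).const_mul K
  have iG : ∀ n, ∫⁻ y, K * (‖F n y‖ₑ ^ p + ‖f y‖ₑ ^ p) ∂ν = K * (I + I) := by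
    intro n
    rw [lintegral_const_mul' _ _ hKtop, lintegral_add_left' (mF n), hn]
  have hKI : K * (I + I) ≠ ∞ := ENNReal.mul_ne_top hKtop (ENNReal.add_ne_top.2 ⟨hfin, hfin⟩)
  set d : ℕ → ℝ≥0∞ := fun n => ∫⁻ y, ‖F n y - f y‖ₑ ^ p ∂ν with hd
  have hdle : ∀ n, d n ≤ K * (I + I) := fun n => by
    rw [← iG n]; exact lintegral_mono (hpt n)
  have fat := lintegral_liminf_le' (μ := ν) (u := atTop) (f := fun n y =>
    K * (‖F n y‖ₑ ^ p + ‖f y‖ₑ ^ p) - ‖F n y - f y‖ₑ ^ p) (fun n => (mG n).sub (md n))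
  have e1 : ∀ n, ∫⁻ y, (K * (‖F n y‖ₑ ^ p + ‖f y‖ₑ ^ p) - ‖F n y - f y‖ₑ ^ p) ∂ν
      = K * (I + I) - d n := by
    intro n
    rw [lintegral_sub' (md n) (ne_top_of_le_ne_top hKI (hdle n)) (ae_of_all _ (hpt n)), iG]
  have e2 : ∫⁻ y, liminf (fun n => K * (‖F n y‖ₑ ^ p + ‖f y‖ₑ ^ p) - ‖F n y - f y‖ₑ ^ p) atTop ∂ν
      = K * (I + I) := by
    have : ∀ᵐ y ∂ν, liminf (fun n => K * (‖F n y‖ₑ ^ p + ‖f y‖ₑ ^ p) - ‖F n y - f y‖ₑ ^ p) atTop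
        = K * (‖f y‖ₑ ^ p + ‖f y‖ₑ ^ p) := by
      filter_upwards [hlim] with y hy
      apply Tendsto.liminf_eq
      have t1 : Tendsto (fun n => ‖F n y‖ₑ ^ p) atTop (𝓝 (‖f y‖ₑ ^ p)) :=
        (ENNReal.continuous_rpow_const.tendsto _).comp ((continuous_enorm.tendsto _).comp hy)
      have t2 : Tendsto (fun n => ‖F n y - f y‖ₑ ^ p) atTop (𝓝 0) := by
        have := (ENNReal.continuous_rpow_const (y := p)).tendsto (‖f y - f y‖ₑ) |>.comp
          ((continuous_enorm.tendsto _).comp (hy.sub_const (f y)))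
        simpa [hp0, Function.comp_def] using this
      have t3 : Tendsto (fun n => K * (‖F n y‖ₑ ^ p + ‖f y‖ₑ ^ p)) atTop
          (𝓝 (K * (‖f y‖ₑ ^ p + ‖f y‖ₑ ^ p))) :=
        ENNReal.Tendsto.const_mul (t1.add tendsto_const_nhds) (Or.inr hKtop)
      have := ENNReal.Tendsto.sub t3 t2 (Or.inr (by simp))
      simpa using this
    rw [lintegral_congr_ae this, lintegral_const_mul' _ _ hKtop, lintegral_add_left' mf]
  simp_rw [e1] at fat
  rw [e2] at fat
  -- conclude
  rw [ENNReal.tendsto_nhds_zero]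
  intro ε hε
  by_cases h0 : K * (I + I) = 0
  · exact Eventually.of_forall fun n => (hdle n).trans (by rw [h0]; exact zero_le)
  have hlt : K * (I + I) - ε < liminf (fun n => K * (I + I) - d n) atTop :=
    lt_of_lt_of_le (ENNReal.sub_lt_self hKI h0 hε.ne') fat
  filter_upwards [eventually_lt_of_lt_liminf hlt] with n hn'
  by_contra hcon
  push Not at hcon
  exact absurd hn' (not_lt.2 (tsub_le_tsub_left hcon.le _))

/-- Composition with a.e. converging measure preserving maps converges strongly in `L_p`. -/
lemma aux_comp {Y : Type*} [TopologicalSpace Y] [NormalSpace Y] [MeasurableSpace Y] [BorelSpace Y]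
    [SecondCountableTopology Y]
    {ν : Measure Y} [ν.WeaklyRegular] {p : ℝ} (hp : 1 ≤ p)
    (S : ℕ → Y → Y) (S₀ : Y → Y) (hS : ∀ n, MeasurePreserving (S n) ν ν)
    (hS₀ : MeasurePreserving S₀ ν ν) (hlim : ∀ᵐ y ∂ν, Tendsto (fun n => S n y) atTop (𝓝 (S₀ y)))
    (f : Y → ℂ) (hf : MemLp f (ENNReal.ofReal p) ν) :
    Tendsto (fun n => eLpNorm (fun y => f (S n y) - f (S₀ y)) (ENNReal.ofReal p) ν) atTop (𝓝 0) := by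
  have hp0 : 0 < p := by linarith
  have hq0 : ENNReal.ofReal p ≠ 0 := by simpa using hp0
  have hq1 : 1 ≤ ENNReal.ofReal p := by simpa using hp
  have conv : ∀ h : Y → ℂ, eLpNorm h (ENNReal.ofReal p) ν = (∫⁻ y, ‖h y‖ₑ ^ p ∂ν) ^ (1 / p) := by
    intro h
    rw [eLpNorm_eq_lintegral_rpow_enorm_toReal hq0 (by simp), ENNReal.toReal_ofReal hp0.le]
  rw [ENNReal.tendsto_nhds_zero]
  intro ε hε
  have hε3 : ε / 3 ≠ 0 := (ENNReal.div_pos hε.ne' (by simp)).ne'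
  obtain ⟨g, hg, hgm⟩ := hf.exists_boundedContinuous_eLpNorm_sub_le (by simp) hε3
  have hfin : ∫⁻ y, ‖g (S₀ y)‖ₑ ^ p ∂ν ≠ ∞ := by
    have := (hgm.comp_measurePreserving hS₀).2
    rw [conv] at this
    intro h
    simp only [Function.comp_apply] at this
    rw [h] at this
    rw [ENNReal.top_rpow_of_pos (by positivity)] at this
    exact lt_irrefl _ this
  have hgS : ∀ (T : Y → Y), MeasurePreserving T ν ν → ∫⁻ y, ‖g (T y)‖ₑ ^ p ∂ν = ∫⁻ y, ‖g y‖ₑ ^ p ∂ν :=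
    fun T hT => hT.lintegral_comp (f := fun y => ‖g y‖ₑ ^ p)
      ((g.continuous.measurable.enorm).pow_const p)
  have hr := aux_riesz hp (fun n y => g (S n y)) (fun y => g (S₀ y))
    (fun n => (g.continuous.measurable.comp (hS n).measurable).aestronglyMeasurable)
    ((g.continuous.measurable.comp hS₀.measurable).aestronglyMeasurable) hfin
    (fun n => by rw [hgS _ (hS n), hgS _ hS₀])
    (by filter_upwards [hlim] with y hy using (g.continuous.tendsto _).comp hy)
  have hr2 : Tendsto (fun n => eLpNorm (fun y => g (S n y) - g (S₀ y)) (ENNReal.ofReal p) ν)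
      atTop (𝓝 0) := by
    simp_rw [conv]
    have := ((ENNReal.continuous_rpow_const (y := 1 / p)).tendsto 0).comp hr
    simpa [hp0, Function.comp_def] using this
  rw [ENNReal.tendsto_nhds_zero] at hr2
  filter_upwards [hr2 (ε / 3) (pos_iff_ne_zero.2 hε3)] with n hn
  have hfg := hf.1.sub hgm.1
  have b1 : ∀ (T : Y → Y), MeasurePreserving T ν ν →
      eLpNorm (fun y => f (T y) - g (T y)) (ENNReal.ofReal p) ν ≤ ε / 3 := by
    intro T hT
    have := eLpNorm_comp_measurePreserving (p := ENNReal.ofReal p) hfg hT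
    exact this.le.trans hg
  have m1 : ∀ (T : Y → Y), MeasurePreserving T ν ν →
      AEStronglyMeasurable (fun y => f (T y) - g (T y)) ν := fun T hT => hfg.comp_measurePreserving hT
  have m2 : AEStronglyMeasurable (fun y => g (S n y) - g (S₀ y)) ν :=
    (hgm.1.comp_measurePreserving (hS n)).sub (hgm.1.comp_measurePreserving hS₀)
  have dec : (fun y => f (S n y) - f (S₀ y)) = (fun y => f (S n y) - g (S n y))
      + (fun y => g (S n y) - g (S₀ y)) - (fun y => f (S₀ y) - g (S₀ y)) := by
    ext y; simp
  rw [dec]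
  calc _ ≤ _ := eLpNorm_sub_le ((m1 _ (hS n)).add m2) (m1 _ hS₀) hq1
    _ ≤ _ := add_le_add (eLpNorm_add_le (m1 _ (hS n)) m2 hq1) le_rfl
    _ ≤ ε / 3 + ε / 3 + ε / 3 := add_le_add (add_le_add (b1 _ (hS n)) hn) (b1 _ hS₀)
    _ = ε := ENNReal.add_thirds ε


/-- The standard Gaussian measure on `ℝ^ι`. -/
noncomputable abbrev gP (ι : Type) : Measure (ι → ℝ) :=
  Measure.infinitePi (fun _ : ι => gaussianReal 0 1)

lemma gP_indep (ι : Type) : iIndepFun (fun (i : ι) (ω : ι → ℝ) => ω i) (gP ι) :=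
  iIndepFun_infinitePi (X := fun _ x => x) (fun _ => measurable_id)

lemma gP_map_eval {ι : Type} (i : ι) : (gP ι).map (fun ω => ω i) = gaussianReal 0 1 :=
  Measure.infinitePi_map_eval _ i

lemma gP_mp_eval {ι : Type} (i : ι) :
    MeasurePreserving (fun ω : ι → ℝ => ω i) (gP ι) (gaussianReal 0 1) :=
  ⟨measurable_pi_apply i, gP_map_eval i⟩

lemma gP_memLp {ι : Type} (i : ι) : MemLp (fun ω : ι → ℝ => ω i) 2 (gP ι) :=
  (memLp_id_gaussianReal 2).comp_measurePreserving (gP_mp_eval i)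

lemma gP_integral {ι : Type} (i : ι) : ∫ ω, ω i ∂(gP ι) = 0 := by
  have := integral_map (μ := gP ι) (φ := fun ω => ω i) (measurable_pi_apply i).aemeasurable
    (f := fun x : ℝ => x) aestronglyMeasurable_id
  rw [← this, gP_map_eval, integral_id_gaussianReal]

lemma gP_integral_sq {ι : Type} (i : ι) : ∫ ω, ω i * ω i ∂(gP ι) = 1 := by
  have := integral_map (μ := gP ι) (φ := fun ω => ω i) (measurable_pi_apply i).aemeasurable
    (f := fun x : ℝ => x * x) (by fun_prop)
  rw [← this, gP_map_eval]
  have h := variance_fun_id_gaussianReal (μ := 0) (v := 1)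
  rw [variance_eq_integral (by fun_prop)] at h
  simpa [integral_id_gaussianReal, sq] using h

/-- The coordinate functions as elements of `L²`. -/
noncomputable def gV {ι : Type} (i : ι) : Lp ℝ 2 (gP ι) := (gP_memLp i).toLp _

lemma gV_coe {ι : Type} (i : ι) : gV i =ᵐ[gP ι] fun ω => ω i := (gP_memLp i).coeFn_toLp

lemma gP_orthonormal (ι : Type) : Orthonormal ℝ (fun i : ι => gV i) := by
  classical
  rw [orthonormal_iff_ite]
  intro i j
  rw [L2.inner_def]
  have : ∫ a, inner ℝ (gV i a) (gV j a) ∂(gP ι)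
      = ∫ a, a i * a j ∂(gP ι) := by
    apply integral_congr_ae
    filter_upwards [gV_coe i, gV_coe j] with a h1 h2
    rw [h1, h2]; simp [mul_comm]
  rw [this]
  split_ifs with h
  · subst h; exact gP_integral_sq i
  · have hi := (gP_indep ι).indepFun h
    have := hi.integral_mul_eq_mul_integral
      (measurable_pi_apply i).aestronglyMeasurable (measurable_pi_apply j).aestronglyMeasurable
    simp only [Pi.mul_def] at this
    rw [this, gP_integral, zero_mul]

lemma exists_W {ι H : Type} [NormedAddCommGroup H] [InnerProductSpace ℝ H] (e : HilbertBasis ι ℝ H) :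
    ∃ W : H →ₗᵢ[ℝ] Lp ℝ 2 (gP ι), ∀ i, W (e i) =ᵐ[gP ι] fun ω => ω i := by
  classical
  refine ⟨(gP_orthonormal ι).orthogonalFamily.linearIsometry.comp e.repr.toLinearIsometry, ?_⟩
  intro i
  have : ((gP_orthonormal ι).orthogonalFamily.linearIsometry.comp e.repr.toLinearIsometry) (e i)
      = gV i := by
    simp only [LinearIsometry.coe_comp, Function.comp_apply, LinearIsometryEquiv.coe_toLinearIsometry,
      HilbertBasis.repr_self, OrthogonalFamily.linearIsometry_apply_single]
    simp
  rw [this]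
  exact gV_coe i

section
variable {ι H : Type} [NormedAddCommGroup H] [InnerProductSpace ℝ H] (e : HilbertBasis ι ℝ H)
  (W : H →ₗᵢ[ℝ] Lp ℝ 2 (gP ι))

lemma W_sum (hW : ∀ i, W (e i) =ᵐ[gP ι] fun ω => ω i) (s : Finset ι) (c : ι → ℝ) :
    W (∑ i ∈ s, c i • e i) =ᵐ[gP ι] fun ω => ∑ i ∈ s, c i * ω i := by
  classical
  induction s using Finset.induction_on with
  | empty =>
    simp only [Finset.sum_empty, map_zero]
    exact Lp.coeFn_zero _ _ _
  | insert a s ha ih =>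
    rw [Finset.sum_insert ha, map_add, map_smul]
    filter_upwards [ih, hW a, Lp.coeFn_add (c a • W (e a)) (W (∑ i ∈ s, c i • e i)),
      Lp.coeFn_smul (c a) (W (e a))] with ω h1 h2 h3 h4
    rw [h3, Finset.sum_insert ha, Pi.add_apply, h4, Pi.smul_apply, h1, h2, smul_eq_mul]

lemma char_sum (s : Finset ι) (c : ι → ℝ) :
    ∫ ω, Complex.exp ((∑ i ∈ s, c i * ω i : ℝ) * Complex.I) ∂(gP ι)
      = Complex.exp (-(((‖∑ i ∈ s, c i • e i‖ : ℝ) : ℂ) ^ 2 / 2)) := by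
  have hind : iIndepFun (fun (i : ι) (ω : ι → ℝ) => c i * ω i) (gP ι) :=
    (gP_indep ι).comp (fun i x => c i * x) (fun i => by fun_prop)
  have h := hind.restrict s |>.charFun_map_fun_finsetSum_eq_prod (s := s) (fun i _ => (by fun_prop : Measurable fun ω : ι → ℝ => c i * ω i).aemeasurable)
  have h1 := congrFun h 1
  have hm : AEMeasurable (fun ω : ι → ℝ => ∑ i ∈ s, c i * ω i) (gP ι) :=
    (by fun_prop : Measurable (fun ω : ι → ℝ => ∑ i ∈ s, c i * ω i)).aemeasurable
  rw [charFun_apply, integral_map hm (by fun_prop)] at h1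
  have e2 : ‖∑ i ∈ s, c i • e i‖ ^ 2 = ∑ i ∈ s, c i ^ 2 := by
    rw [← real_inner_self_eq_norm_sq, e.orthonormal.inner_sum]
    simp [sq]
  have e3 : ∀ i, charFun ((gP ι).map (fun ω => c i * ω i)) 1 = Complex.exp (-((c i : ℂ) ^ 2 / 2)) := by
    intro i
    have : (gP ι).map (fun ω => c i * ω i) = gaussianReal 0 (.mk (c i ^ 2) (sq_nonneg _) * 1) := by
      have h := gaussianReal_map_const_mul (μ := 0) (v := 1) (c i)
      rw [mul_zero] at h
      rw [← h, ← gP_map_eval i, Measure.map_map (by fun_prop) (by fun_prop)]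
      rfl
    rw [this, charFun_gaussianReal]
    congr 1
    simp
  have e4 : (((‖∑ i ∈ s, c i • e i‖ : ℝ) : ℂ) ^ 2 / 2) = ∑ i ∈ s, ((c i : ℂ) ^ 2 / 2) := by
    rw [← Complex.ofReal_pow, e2]; push_cast; rw [Finset.sum_div]
  rw [e4, ← Finset.sum_neg_distrib, Complex.exp_sum]
  rw [Finset.prod_apply] at h1
  simp_rw [e3] at h1
  rw [← h1]
  simp

lemma char_W (hW : ∀ i, W (e i) =ᵐ[gP ι] fun ω => ω i) (ξ : H) : ∫ ω, Complex.exp ((W ξ ω : ℝ) * Complex.I) ∂(gP ι)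
      = Complex.exp (-(((‖ξ‖ : ℝ) : ℂ) ^ 2 / 2)) := by
  have hmeas : ∀ ξ, AEStronglyMeasurable (fun ω => Complex.exp ((W ξ ω : ℝ) * Complex.I)) (gP ι) := by
    intro ξ
    have : Measurable (W ξ) := (Lp.stronglyMeasurable (W ξ)).measurable
    exact (by fun_prop : Measurable fun ω => Complex.exp ((W ξ ω : ℝ) * Complex.I)).aestronglyMeasurable
  have hint : ∀ ξ, Integrable (fun ω => Complex.exp ((W ξ ω : ℝ) * Complex.I)) (gP ι) := by
    intro ξ
    refine Integrable.of_bound (hmeas ξ) 1 (ae_of_all _ fun ω => ?_)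
    rw [Complex.norm_exp_ofReal_mul_I]
  have hc1 : Continuous fun ξ => ∫ ω, Complex.exp ((W ξ ω : ℝ) * Complex.I) ∂(gP ι) := by
    have : LipschitzWith 1 fun ξ => ∫ ω, Complex.exp ((W ξ ω : ℝ) * Complex.I) ∂(gP ι) := by
      apply LipschitzWith.of_dist_le_mul
      intro ξ η
      rw [dist_eq_norm, ← integral_sub (hint ξ) (hint η), NNReal.coe_one, one_mul, dist_eq_norm]
      have hWi : ∀ ζ, Integrable (W ζ) (gP ι) := fun ζ => (Lp.memLp (W ζ)).integrable (by norm_num)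
      calc ‖∫ ω, (Complex.exp ((W ξ ω : ℝ) * Complex.I) - Complex.exp ((W η ω : ℝ) * Complex.I)) ∂(gP ι)‖
          ≤ ∫ ω, ‖W (ξ - η) ω‖ ∂(gP ι) := by
            refine norm_integral_le_of_norm_le (hWi _).norm ?_
            rw [map_sub]
            filter_upwards [Lp.coeFn_sub (W ξ) (W η)] with ω h
            rw [h, Pi.sub_apply]
            have : Complex.exp ((W ξ ω : ℝ) * Complex.I) - Complex.exp ((W η ω : ℝ) * Complex.I)
              = Complex.exp ((W η ω : ℝ) * Complex.I) *
                (Complex.exp (Complex.I * ((W ξ ω - W η ω : ℝ))) - 1) := by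
              rw [mul_sub, ← Complex.exp_add]
              push_cast
              ring_nf
            rw [this, norm_mul, Complex.norm_exp_ofReal_mul_I, one_mul]
            exact Real.norm_exp_I_mul_ofReal_sub_one_le
        _ = (eLpNorm (W (ξ - η)) 1 (gP ι)).toReal := by
            rw [integral_norm_eq_lintegral_enorm (hWi _).1, eLpNorm_one_eq_lintegral_enorm]
        _ ≤ (eLpNorm (W (ξ - η)) 2 (gP ι)).toReal := by
            apply ENNReal.toReal_mono (Lp.eLpNorm_ne_top _)
            exact eLpNorm_le_eLpNorm_of_exponent_le (by norm_num) (hWi _).1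
        _ = ‖ξ - η‖ := by
            rw [← Lp.norm_def, W.norm_map]
    exact this.continuous
  have hc2 : Continuous fun ξ : H => Complex.exp (-(((‖ξ‖ : ℝ) : ℂ) ^ 2 / 2)) := by fun_prop
  have hd : Dense ((Submodule.span ℝ (Set.range e) : Submodule ℝ H) : Set H) := by
    rw [Submodule.dense_iff_topologicalClosure_eq_top]; exact e.dense_span
  refine congrFun (Continuous.ext_on hd hc1 hc2 ?_) ξ
  intro η hη
  obtain ⟨c, rfl⟩ := (Finsupp.mem_span_range_iff_exists_finsupp).1 hη
  simp only [Finsupp.sum]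
  rw [← char_sum e]
  apply integral_congr_ae
  filter_upwards [W_sum e W hW c.support c] with ω h
  rw [h]

lemma W_meas (ξ : H) : Measurable (W ξ) := (Lp.stronglyMeasurable (W ξ)).measurable

lemma char_W' (hW : ∀ i, W (e i) =ᵐ[gP ι] fun ω => ω i) (ξ : H) (t : ℝ) : charFun ((gP ι).map (W ξ)) t
      = Complex.exp (-(((‖t • ξ‖ : ℝ) : ℂ) ^ 2 / 2)) := by
  rw [← char_W e W hW (t • ξ), charFun_apply, integral_map (W_meas W ξ).aemeasurable (by fun_prop)]
  apply integral_congr_ae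
  rw [map_smul]
  filter_upwards [Lp.coeFn_smul t (W ξ)] with ω h
  rw [h]
  simp

lemma T_mp (hW : ∀ i, W (e i) =ᵐ[gP ι] fun ω => ω i) [Countable ι] (A : H →ₗᵢ[ℝ] H) :
    MeasurePreserving (fun (ω : ι → ℝ) (i : ι) => W (A (e i)) ω) (gP ι) (gP ι) := by
  have hm : ∀ i, Measurable (W (A (e i))) := fun i => W_meas W _
  refine ⟨measurable_pi_lambda _ hm, ?_⟩
  have hnorm : ∀ i, ‖A (e i)‖ = 1 := fun i => by rw [A.norm_map]; exact e.orthonormal.1 i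
  have hmap : ∀ i, (gP ι).map (W (A (e i))) = gaussianReal 0 1 := by
    intro i
    have : IsProbabilityMeasure ((gP ι).map (W (A (e i)))) :=
      Measure.isProbabilityMeasure_map (hm i).aemeasurable
    apply Measure.ext_of_charFun
    ext t
    rw [char_W' e W hW, charFun_gaussianReal, norm_smul, hnorm]
    congr 1
    rw [← Complex.ofReal_pow]
    simp
  have hind : iIndepFun (fun i => (W (A (e i)) : (ι → ℝ) → ℝ)) (gP ι) := by
    rw [iIndepFun_iff_finset]
    intro s
    refine (iIndepFun_iff_charFun_pi (P := gP ι)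
      (X := s.restrict (fun i => (W (A (e i)) : (ι → ℝ) → ℝ))) (fun i => (hm i).aemeasurable)).2 ?_
    intro t
    have hmm : Measurable fun ω : ι → ℝ => WithLp.toLp 2 (fun i : s => s.restrict (fun i => (W (A (e i)) : (ι → ℝ) → ℝ)) i ω) :=
      (WithLp.measurable_toLp 2 _).comp (measurable_pi_lambda _ fun i => hm i)
    rw [charFun_apply, integral_map hmm.aemeasurable (by fun_prop)]
    classical
    let c : ι → ℝ := fun i => if h : i ∈ s then t ⟨i, h⟩ else 0
    have hc : ∀ i : s, c i = t i := fun i => by simp [c]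
    have e1 : ∏ i : s, charFun ((gP ι).map (s.restrict (fun i => (W (A (e i)) : (ι → ℝ) → ℝ)) i)) (t i)
        = Complex.exp (-(((‖A (∑ i ∈ s, c i • e i)‖ : ℝ) : ℂ) ^ 2 / 2)) := by
      have : ∀ i : s, charFun ((gP ι).map (s.restrict (fun i => (W (A (e i)) : (ι → ℝ) → ℝ)) i)) (t i)
        = Complex.exp (-((c i : ℂ) ^ 2 / 2)) := by
        intro i
        rw [Finset.restrict, char_W' e W hW, norm_smul, hnorm, hc, ← Complex.ofReal_pow]
        simp
      simp_rw [this]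
      rw [← Complex.exp_sum, A.norm_map]
      have e2 : ‖∑ i ∈ s, c i • e i‖ ^ 2 = ∑ i ∈ s, c i ^ 2 := by
        rw [← real_inner_self_eq_norm_sq, e.orthonormal.inner_sum]
        simp [sq]
      rw [← Complex.ofReal_pow, e2]
      push_cast
      rw [Finset.sum_div, ← Finset.sum_neg_distrib, ← Finset.sum_coe_sort s]
    rw [e1, ← char_W e W hW]
    apply integral_congr_ae
    have hs : ∀ᵐ ω ∂(gP ι), W (A (∑ i ∈ s, c i • e i)) ω = ∑ i ∈ s, c i * W (A (e i)) ω := by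
      have : ∀ s' : Finset ι, ∀ᵐ ω ∂(gP ι), W (A (∑ i ∈ s', c i • e i)) ω = ∑ i ∈ s', c i * W (A (e i)) ω := by
        intro s'
        induction s' using Finset.induction_on with
        | empty =>
          simp only [Finset.sum_empty, map_zero]
          exact Lp.coeFn_zero _ _ _
        | insert a s' ha ih =>
          rw [Finset.sum_insert ha, map_add, map_add, map_smul, map_smul]
          filter_upwards [ih, Lp.coeFn_add (c a • W (A (e a))) (W (A (∑ i ∈ s', c i • e i))),
            Lp.coeFn_smul (c a) (W (A (e a)))] with ω h1 h3 h4
          rw [h3, Finset.sum_insert ha, Pi.add_apply, h4, Pi.smul_apply, h1, smul_eq_mul]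
      exact this s
    filter_upwards [hs] with ω h
    rw [h, PiLp.inner_apply, ← Finset.sum_coe_sort s]
    congr 3
    apply Finset.sum_congr rfl
    intro i _
    simp [hc]
  rw [hind.map_fun_eq_infinitePi_map hm]
  simp_rw [hmap]

lemma W_comp (hW : ∀ i, W (e i) =ᵐ[gP ι] fun ω => ω i) [Countable ι] (A : H →ₗᵢ[ℝ] H) (ξ : H) :
    (fun ω => W ξ (fun i => W (A (e i)) ω)) =ᵐ[gP ι] W (A ξ) := by
  have hT := T_mp e W hW A
  let L1 : H →L[ℝ] Lp ℝ 2 (gP ι) :=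
    ((Lp.compMeasurePreservingₗᵢ ℝ _ hT).comp W).toContinuousLinearMap
  let L2 : H →L[ℝ] Lp ℝ 2 (gP ι) := (W.comp A).toContinuousLinearMap
  have hd : Dense ((Submodule.span ℝ (Set.range e) : Submodule ℝ H) : Set H) := by
    rw [Submodule.dense_iff_topologicalClosure_eq_top]; exact e.dense_span
  have : L1 = L2 := by
    apply ContinuousLinearMap.ext_on hd
    rintro _ ⟨i, rfl⟩
    apply Lp.ext
    have h1 : L1 (e i) =ᵐ[gP ι] W (e i) ∘ _ := Lp.coeFn_compMeasurePreserving (W (e i)) hT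
    refine h1.trans ?_
    have := hT.quasiMeasurePreserving.ae_eq_comp (hW i)
    exact this
  have h2 : L1 ξ =ᵐ[gP ι] W ξ ∘ _ := Lp.coeFn_compMeasurePreserving (W ξ) hT
  rw [this] at h2
  exact h2.symm
end

end

section
open Filter Topology ProbabilityTheory

lemma hb_countable {ι H : Type} [NormedAddCommGroup H] [InnerProductSpace ℝ H]
    [TopologicalSpace.SeparableSpace H] (e : HilbertBasis ι ℝ H) : Countable ι := by
  refine Pairwise.countable_of_isOpen_disjoint (s := fun i => Metric.ball (e i) (1/2)) ?_
    (fun i => Metric.isOpen_ball) (fun i => ⟨e i, Metric.mem_ball_self (by norm_num)⟩)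
  intro i j hij
  apply Metric.ball_disjoint_ball
  have h : ‖e i - e j‖ ^ 2 = 2 := by
    rw [norm_sub_sq_real, e.orthonormal.1 i, e.orthonormal.1 j, e.orthonormal.2 hij]; norm_num
  rw [dist_eq_norm]
  nlinarith [norm_nonneg (e i - e j)]

variable {ι H : Type} [NormedAddCommGroup H] [InnerProductSpace ℝ H]

lemma W_lint (W : H →ₗᵢ[ℝ] Lp ℝ 2 (gP ι)) (ξ η : H) :
    ∫⁻ ω, ‖W ξ ω - W η ω‖ₑ ^ (2 : ℝ) ∂(gP ι) = ENNReal.ofReal (‖ξ - η‖ ^ 2) := by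
  have h1 : ∫⁻ ω, ‖W ξ ω - W η ω‖ₑ ^ (2 : ℝ) ∂(gP ι) = ∫⁻ ω, ‖W (ξ - η) ω‖ₑ ^ (2 : ℝ) ∂(gP ι) := by
    apply lintegral_congr_ae
    rw [map_sub]
    filter_upwards [Lp.coeFn_sub (W ξ) (W η)] with ω h
    rw [h, Pi.sub_apply]
  have h2 := Lp.norm_def (W (ξ - η))
  rw [W.norm_map] at h2
  rw [h1, h2, ← ENNReal.toReal_pow, ENNReal.ofReal_toReal (ENNReal.pow_ne_top (Lp.eLpNorm_ne_top _)),
    eLpNorm_eq_lintegral_rpow_enorm_toReal (by simp) (by simp), ENNReal.toReal_ofNat,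
    ← ENNReal.rpow_natCast, ← ENNReal.rpow_mul]
  norm_num

lemma aux_diag (W : H →ₗᵢ[ℝ] Lp ℝ 2 (gP ι)) {κ : Type} [Countable κ] (ξ : ℕ → κ → H) (ξ₀ : κ → H)
    (h : ∀ j, Tendsto (fun n => ξ n j) atTop (𝓝 (ξ₀ j))) :
    ∃ φ : ℕ → ℕ, StrictMono φ ∧ ∀ᵐ ω ∂(gP ι), ∀ j,
      Tendsto (fun n => W (ξ (φ n) j) ω) atTop (𝓝 (W (ξ₀ j) ω)) := by
  obtain ⟨_⟩ := nonempty_encodable κ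
  obtain ⟨φ, hφ, hP⟩ := extraction_forall_of_eventually
    (P := fun n k => ∀ j, Encodable.encode j ≤ n → ‖ξ k j - ξ₀ j‖ ^ 2 ≤ (1 / 2 : ℝ) ^ n) (by
      intro n
      have hfin : {j : κ | Encodable.encode j ≤ n}.Finite :=
        (Set.finite_Iic n).preimage Encodable.encode_injective.injOn
      refine (eventually_all_finite hfin).2 fun j _ => ?_
      have : Tendsto (fun k => ‖ξ k j - ξ₀ j‖ ^ 2) atTop (𝓝 0) := by
        have := ((h j).sub_const (ξ₀ j)).norm.pow 2
        simpa using this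
      exact this.eventually (eventually_le_nhds (by positivity)))
  refine ⟨φ, hφ, ?_⟩
  rw [ae_all_iff]
  intro j
  set m := Encodable.encode j
  have hmeas : ∀ n, AEMeasurable (fun ω => ‖W (ξ (φ (n + m)) j) ω - W (ξ₀ j) ω‖ₑ ^ (2 : ℝ)) (gP ι) :=
    fun n => (((W_meas W _).sub (W_meas W _)).enorm.pow_const _).aemeasurable
  have hsum : ∫⁻ ω, ∑' n, ‖W (ξ (φ (n + m)) j) ω - W (ξ₀ j) ω‖ₑ ^ (2 : ℝ) ∂(gP ι) ≠ ∞ := by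
    rw [lintegral_tsum hmeas]
    simp_rw [W_lint]
    have : ∑' n : ℕ, ENNReal.ofReal ((1 / 2 : ℝ) ^ n) ≠ ∞ :=
      (summable_geometric_of_lt_one (by norm_num) (by norm_num)).tsum_ofReal_ne_top
    refine ne_top_of_le_ne_top this (ENNReal.tsum_le_tsum fun n => ENNReal.ofReal_le_ofReal ?_)
    refine (hP (n + m) j (by omega)).trans ?_
    exact pow_le_pow_of_le_one (by norm_num) (by norm_num) (by omega)
  have hae := ae_lt_top' (AEMeasurable.tsum hmeas) hsum
  filter_upwards [hae] with ω hω
  rw [← tendsto_add_atTop_iff_nat m, tendsto_iff_edist_tendsto_0]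
  have h0 := ENNReal.tendsto_atTop_zero_of_tsum_ne_top hω.ne
  have h1 := ((ENNReal.continuous_rpow_const (y := 1 / 2)).tendsto 0).comp h0
  simp only [Function.comp_def, ← ENNReal.rpow_mul] at h1
  simpa [edist_eq_enorm_sub] using h1

lemma pPow_eq {X : Type*} [MeasurableSpace X] (μ : Measure X) {p : ℝ} (hp : 0 < p)
    (f : X →ₘ[μ] ℂ) : pPow μ p f = (eLpNorm f (ENNReal.ofReal p) μ) ^ p := by
  rw [eLpNorm_eq_lintegral_rpow_enorm_toReal (by simpa using hp) (by simp),
    ENNReal.toReal_ofReal hp.le, ← ENNReal.rpow_mul, one_div, inv_mul_cancel₀ hp.ne',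
    ENNReal.rpow_one]
  rfl

lemma eLpNorm_eq' {X : Type*} [MeasurableSpace X] (μ : Measure X) {p : ℝ} (hp : 0 < p)
    (f : X → ℂ) : eLpNorm f (ENNReal.ofReal p) μ = (∫⁻ x, ‖f x‖ₑ ^ p ∂μ) ^ (1 / p) := by
  rw [eLpNorm_eq_lintegral_rpow_enorm_toReal (by simpa using hp) (by simp),
    ENNReal.toReal_ofReal hp.le]

/-- The infinite measure space carrying the `L_p` action. -/
noncomputable abbrev gN (ι : Type) : Measure ((ι → ℝ) × ℝ) := (gP ι).prod volume

/-- The skew product transformation associated with an affine isometry `ξ ↦ A ξ + b`. -/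
noncomputable def gS (e : HilbertBasis ι ℝ H) (W : H →ₗᵢ[ℝ] Lp ℝ 2 (gP ι)) (A : H →ₗᵢ[ℝ] H) (b : H)
    (y : (ι → ℝ) × ℝ) : (ι → ℝ) × ℝ := (fun i => W (A (e i)) y.1, y.2 + W b y.1)

lemma gS_mp [Countable ι] (e : HilbertBasis ι ℝ H) (W : H →ₗᵢ[ℝ] Lp ℝ 2 (gP ι))
    (hW : ∀ i, W (e i) =ᵐ[gP ι] fun ω => ω i) (A : H →ₗᵢ[ℝ] H) (b : H) :
    MeasurePreserving (gS e W A b) (gN ι) (gN ι) := by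
  have := (T_mp e W hW A).skew_product (μc := (volume : Measure ℝ)) (μd := volume)
    (g := fun ω s => s + W b ω)
    (measurable_snd.add ((W_meas W b).comp measurable_fst))
    (ae_of_all _ fun ω => map_add_right_eq_self volume _)
  exact this

lemma ae_fst {P : (ι → ℝ) → Prop} (h : ∀ᵐ ω ∂(gP ι), P ω) : ∀ᵐ y ∂(gN ι), P y.1 :=
  Measure.quasiMeasurePreserving_fst.ae h

lemma gS_one (e : HilbertBasis ι ℝ H) (W : H →ₗᵢ[ℝ] Lp ℝ 2 (gP ι)) [Countable ι]
    (hW : ∀ i, W (e i) =ᵐ[gP ι] fun ω => ω i) : ∀ᵐ y ∂(gN ι), gS e W LinearIsometry.id 0 y = y := by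
  have h1 : ∀ᵐ ω ∂(gP ι), ∀ i, W (e i) ω = ω i := ae_all_iff.2 hW
  have h2 : ∀ᵐ ω ∂(gP ι), W 0 ω = 0 := by rw [map_zero]; exact Lp.coeFn_zero _ _ _
  filter_upwards [ae_fst h1, ae_fst h2] with y hy1 hy2
  simp only [gS, LinearIsometry.id_apply, hy1, hy2, add_zero]

lemma gS_mul (e : HilbertBasis ι ℝ H) (W : H →ₗᵢ[ℝ] Lp ℝ 2 (gP ι)) [Countable ι]
    (hW : ∀ i, W (e i) =ᵐ[gP ι] fun ω => ω i) (A A' : H →ₗᵢ[ℝ] H) (b b' : H) :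
    ∀ᵐ y ∂(gN ι), gS e W A' b' (gS e W A b y) = gS e W (A.comp A') (A b' + b) y := by
  have h1 : ∀ᵐ ω ∂(gP ι), ∀ i, W (A' (e i)) (fun j => W (A (e j)) ω) = W (A (A' (e i))) ω :=
    ae_all_iff.2 fun i => W_comp e W hW A _
  have h2 := W_comp e W hW A b'
  have h3 : ∀ᵐ ω ∂(gP ι), W (A b' + b) ω = W (A b') ω + W b ω := by
    rw [map_add]; exact Lp.coeFn_add _ _
  filter_upwards [ae_fst h1, ae_fst h2, ae_fst h3] with y hy1 hy2 hy3
  simp only [gS, LinearIsometry.coe_comp, Function.comp_apply, hy1, hy2, hy3]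
  congr 1
  ring

lemma theta_lint (W : H →ₗᵢ[ℝ] Lp ℝ 2 (gP ι)) {p : ℝ} {θ : ℝ → ℂ} (hθ : Measurable θ)
    (hθp : ∀ x y : ℝ, ∫⁻ s : ℝ, ‖θ (s + x) - θ (s + y)‖ₑ ^ p = ‖x - y‖ₑ ^ (2 : ℝ)) (ξ η : H) :
    ∫⁻ y, ‖θ (y.2 + W ξ y.1) - θ (y.2 + W η y.1)‖ₑ ^ p ∂(gN ι) = ENNReal.ofReal (‖ξ - η‖ ^ 2) := by
  have m : ∀ ζ, Measurable fun y : (ι → ℝ) × ℝ => θ (y.2 + W ζ y.1) := fun ζ =>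
    hθ.comp (measurable_snd.add ((W_meas W ζ).comp measurable_fst))
  have hm : Measurable fun y : (ι → ℝ) × ℝ => ‖θ (y.2 + W ξ y.1) - θ (y.2 + W η y.1)‖ₑ ^ p :=
    ((m ξ).sub (m η)).enorm.pow_const p
  rw [lintegral_prod _ hm.aemeasurable]
  simp only [hθp]
  exact W_lint W ξ η

lemma main_action {G : Type*} [Group G] [TopologicalSpace G] [CompleteSpace H]
    [TopologicalSpace.SeparableSpace H]
    {p : ℝ} (hp : 2 < p) (A : G → H →ₗᵢ[ℝ] H) (b : G → H)
    (hA1 : A 1 = LinearIsometry.id) (hb1 : b 1 = 0)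
    (hAm : ∀ g h, A (g * h) = (A g).comp (A h)) (hbm : ∀ g h, b (g * h) = A g (b h) + b g)
    (hAc : ∀ ξ, Continuous fun g => A g ξ) (hbc : Continuous b) :
    ∃ (Y : Type) (_ : MeasurableSpace Y) (ν : Measure Y),
      StandardBorelSpace Y ∧ SigmaFinite ν ∧
      ∃ β : AffineIsometricAction G ν p,
        ∀ g : G, ENNReal.ofReal (‖b g‖ ^ 2) = pPow ν p ((β.act g 0 : Y →ₘ[ν] ℂ)) := by
  have hp0 : 0 < p := by linarith
  obtain ⟨w, e, -⟩ := exists_hilbertBasis ℝ H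
  have hcount : Countable w := hb_countable e
  obtain ⟨W, hW⟩ := exists_W e
  obtain ⟨θ, hθ, hθp⟩ := exists_theta hp
  let ν := gN w
  let S : G → (w → ℝ) × ℝ → (w → ℝ) × ℝ := fun g => gS e W (A g) (b g)
  have hS : ∀ g, MeasurePreserving (S g) ν ν := fun g => gS_mp e W hW (A g) (b g)
  have hS1 : ∀ᵐ y ∂ν, S 1 y = y := by
    have := gS_one e W hW
    simpa only [S, hA1, hb1] using this
  have hSm : ∀ g h, ∀ᵐ y ∂ν, S h (S g y) = S (g * h) y := by
    intro g h
    have := gS_mul e W hW (A g) (A h) (b g) (b h)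
    simpa only [S, hAm, hbm] using this
  have mθS : ∀ g, Measurable fun y => θ (S g y).2 := fun g =>
    hθ.comp (measurable_snd.comp (hS g).measurable)
  have hcint : ∀ g g', ∫⁻ y, ‖θ (S g y).2 - θ (S g' y).2‖ₑ ^ p ∂ν = ENNReal.ofReal (‖b g - b g'‖ ^ 2) :=
    fun g g' => theta_lint W hθ hθp (b g) (b g')
  have hcint1 : ∀ g, ∫⁻ y, ‖θ (S g y).2 - θ y.2‖ₑ ^ p ∂ν = ENNReal.ofReal (‖b g‖ ^ 2) := by
    intro g
    have h := hcint g 1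
    rw [hb1, sub_zero] at h
    rw [← h]
    apply lintegral_congr_ae
    filter_upwards [hS1] with y hy
    rw [hy]
  have hcmem : ∀ g, MemLp (fun y : (w → ℝ) × ℝ => θ (S g y).2 - θ y.2) (ENNReal.ofReal p) ν := by
    intro g
    refine ⟨((mθS g).sub (hθ.comp measurable_snd)).aestronglyMeasurable, ?_⟩
    rw [eLpNorm_eq' _ hp0, hcint1]
    exact ENNReal.rpow_lt_top_of_nonneg (by positivity) ENNReal.ofReal_ne_top
  let act : G → Lp ℂ (ENNReal.ofReal p) ν → Lp ℂ (ENNReal.ofReal p) ν := fun g f =>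
    Lp.compMeasurePreserving (S g) (hS g) f + (hcmem g).toLp _
  have coe_act : ∀ g f, act g f =ᵐ[ν] fun y => f (S g y) + (θ (S g y).2 - θ y.2) := by
    intro g f
    filter_upwards [Lp.coeFn_add (Lp.compMeasurePreserving (S g) (hS g) f) ((hcmem g).toLp _),
      Lp.coeFn_compMeasurePreserving f (hS g), (hcmem g).coeFn_toLp] with y h1 h2 h3
    rw [h1, Pi.add_apply, h2, h3, Function.comp_apply]
  have pPow_congr : ∀ (F : (w → ℝ) × ℝ →ₘ[ν] ℂ) (F' : (w → ℝ) × ℝ → ℂ), F =ᵐ[ν] F' →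
      pPow ν p F = ∫⁻ y, ‖F' y‖ₑ ^ p ∂ν := by
    intro F F' h
    apply lintegral_congr_ae
    filter_upwards [h] with y hy
    rw [hy]; rfl
  refine ⟨(w → ℝ) × ℝ, inferInstance, ν, inferInstance, inferInstance,
    { act := act
      act_one := ?_
      act_mul := ?_
      isometry := ?_
      affine := ?_
      continuous := ?_ }, ?_⟩
  · intro f
    apply Lp.ext
    filter_upwards [coe_act 1 f, hS1] with y h1 h2
    rw [h1, h2, sub_self, add_zero]
  · intro g h f
    apply Lp.ext
    have h2 := (hS g).quasiMeasurePreserving.ae (coe_act h f)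
    filter_upwards [coe_act (g * h) f, coe_act g (act h f), h2, hSm g h] with y h1 h2 h3 h4
    rw [h1, h2, h3, h4]
    ring
  · intro g f f'
    rw [pPow_congr _ (fun y => f (S g y) - f' (S g y)),
      pPow_congr _ (fun y => f y - f' y) (AEEqFun.coeFn_sub _ _)]
    · exact (hS g).lintegral_comp (f := fun y => ‖f y - f' y‖ₑ ^ p)
        (((Lp.stronglyMeasurable f).measurable.sub (Lp.stronglyMeasurable f').measurable).enorm.pow_const p)
    · filter_upwards [AEEqFun.coeFn_sub (act g f : (w → ℝ) × ℝ →ₘ[ν] ℂ) (act g f'), coe_act g f,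
        coe_act g f'] with y h1 h2 h3
      rw [h1, Pi.sub_apply, h2, h3]; ring
  · intro g t f f'
    apply Lp.ext
    have h0 : ∀ F F' : Lp ℂ (ENNReal.ofReal p) ν, ∀ᵐ y ∂ν, (t • F + (1 - t) • F' : Lp ℂ (ENNReal.ofReal p) ν) y
        = t • F y + (1 - t) • F' y := by
      intro F F'
      filter_upwards [Lp.coeFn_add (t • F) ((1 - t) • F'), Lp.coeFn_smul t F,
        Lp.coeFn_smul (1 - t) F'] with y h1 h2 h3
      rw [h1, Pi.add_apply, h2, h3]; rfl
    have h1 := (hS g).quasiMeasurePreserving.ae (h0 f f')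
    filter_upwards [coe_act g (t • f + (1 - t) • f'), coe_act g f, coe_act g f',
      h1, h0 (act g f) (act g f')] with y h1 h2 h3 h4 h5
    rw [h1, h4, h5, h2, h3]
    simp only [Complex.real_smul]
    push_cast
    ring
  · intro f g₀
    have hfm := (Lp.stronglyMeasurable f).measurable
    -- strong continuity of the linear part
    have lin : Tendsto (fun g => eLpNorm (fun y => f (S g y) - f (S g₀ y)) (ENNReal.ofReal p) ν)
        (𝓝 g₀) (𝓝 0) := by
      let d : G → Option w → H := fun g j => j.elim (b g) (fun i => A g (e i))
      have hd : Continuous d := by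
        refine continuous_pi fun j => ?_
        cases j with
        | none => exact hbc
        | some i => exact hAc (e i)
      have hle : 𝓝 g₀ ≤ comap d (𝓝 (d g₀)) := (hd.tendsto g₀).le_comap
      refine Tendsto.mono_left ?_ hle
      apply tendsto_of_seq_tendsto
      intro u hu
      rw [tendsto_comap_iff] at hu
      apply tendsto_of_subseq_tendsto
      intro ns hns
      have hu2 := hu.comp hns
      obtain ⟨φ, hφ, hae⟩ := aux_diag W (fun n => d (u (ns n))) (d g₀)
        (fun j => (tendsto_pi_nhds.1 hu2) j)
      refine ⟨φ, ?_⟩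
      refine aux_comp (by linarith) (fun n => S (u (ns (φ n)))) (S g₀) (fun n => hS _) (hS g₀) ?_
        f (Lp.memLp f)
      filter_upwards [ae_fst hae] with y hy
      refine Tendsto.prodMk_nhds (tendsto_pi_nhds.2 fun i => hy (some i)) ?_
      exact (hy none).const_add y.2
    have coc : Tendsto (fun g => eLpNorm (fun y => θ (S g y).2 - θ (S g₀ y).2) (ENNReal.ofReal p) ν)
        (𝓝 g₀) (𝓝 0) := by
      simp_rw [eLpNorm_eq' ν hp0, hcint]
      have h1 : Continuous fun g => ENNReal.ofReal (‖b g - b g₀‖ ^ 2) ^ (1 / p) :=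
        ENNReal.continuous_rpow_const.comp (ENNReal.continuous_ofReal.comp (by fun_prop))
      have := h1.tendsto g₀
      simpa [hp0] using this
    have tot := lin.add coc
    rw [add_zero] at tot
    have tot2 := ((ENNReal.continuous_rpow_const (y := p)).tendsto 0).comp tot
    rw [ENNReal.zero_rpow_of_pos hp0] at tot2
    refine tendsto_of_tendsto_of_tendsto_of_le_of_le tendsto_const_nhds tot2
      (fun _ => zero_le) (fun g => ?_)
    rw [pPow_eq ν hp0]
    refine ENNReal.rpow_le_rpow ?_ hp0.le
    have hcongr : ((act g f : (w → ℝ) × ℝ →ₘ[ν] ℂ) - (act g₀ f : (w → ℝ) × ℝ →ₘ[ν] ℂ) :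
        (w → ℝ) × ℝ →ₘ[ν] ℂ) =ᵐ[ν] (fun y => f (S g y) - f (S g₀ y)) +
          (fun y => θ (S g y).2 - θ (S g₀ y).2) := by
      filter_upwards [AEEqFun.coeFn_sub (act g f : (w → ℝ) × ℝ →ₘ[ν] ℂ) (act g₀ f), coe_act g f,
        coe_act g₀ f] with y h1 h2 h3
      rw [h1, Pi.sub_apply, h2, h3, Pi.add_apply]; ring
    rw [eLpNorm_congr_ae hcongr]
    refine eLpNorm_add_le ?_ ?_ ?_
    · exact ((hfm.comp (hS g).measurable).sub (hfm.comp (hS g₀).measurable)).aestronglyMeasurable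
    · exact ((mθS g).sub (mθS g₀)).aestronglyMeasurable
    · rw [ENNReal.one_le_ofReal]; linarith
  · intro g
    rw [← hcint1 g]
    symm
    apply pPow_congr
    have h0 : ∀ᵐ y ∂ν, (0 : Lp ℂ (ENNReal.ofReal p) ν) y = 0 := Lp.coeFn_zero _ _ _
    filter_upwards [coe_act g 0, (hS g).quasiMeasurePreserving.ae h0] with y h1 h2
    rw [h1, h2, zero_add]

/-- Affine isometric actions on a real normed space split into linear part and cocycle. -/
lemma split_action {G : Type*} [Group G] [TopologicalSpace G] {q : ℝ≥0∞} (hq : q = 2)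
    {X : Type} [MeasurableSpace X] [StandardBorelSpace X] (μ : Measure X) [SigmaFinite μ]
    (act : G → Lp ℂ q μ → Lp ℂ q μ) (h1 : ∀ f, act 1 f = f)
    (hm : ∀ g h f, act (g * h) f = act g (act h f))
    (hi : ∀ g f f', eLpNorm (act g f - act g f' : Lp ℂ q μ) q μ = eLpNorm (f - f' : Lp ℂ q μ) q μ)
    (hc : ∀ f g₀, Tendsto (fun g => eLpNorm (act g f - act g₀ f : Lp ℂ q μ) q μ) (𝓝 g₀) (𝓝 0))
    {p : ℝ} (hp : 2 < p) :
    ∃ (Y : Type) (_ : MeasurableSpace Y) (ν : Measure Y),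
      StandardBorelSpace Y ∧ SigmaFinite ν ∧
      ∃ β : AffineIsometricAction G ν p,
        ∀ g : G, (eLpNorm (act g 0) q μ) ^ (2 : ℝ) = pPow ν p ((β.act g 0 : Y →ₘ[ν] ℂ)) := by
  subst hq
  have hiso : ∀ g, Isometry (act g) := by
    intro g
    apply Isometry.of_dist_eq
    intro f f'
    rw [dist_eq_norm, dist_eq_norm, Lp.norm_def, Lp.norm_def, hi]
  let E : G → Lp ℂ 2 μ ≃ᵢ Lp ℂ 2 μ := fun g =>
    { toFun := act g
      invFun := act g⁻¹
      left_inv := fun f => by rw [← hm, inv_mul_cancel, h1]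
      right_inv := fun f => by rw [← hm, mul_inv_cancel, h1]
      isometry_toFun := hiso g }
  let A : G → Lp ℂ 2 μ →ₗᵢ[ℝ] Lp ℂ 2 μ := fun g =>
    ((E g).toRealAffineIsometryEquiv.linearIsometryEquiv).toLinearIsometry
  have hA : ∀ g f, act g f = A g f + act g 0 := by
    intro g f
    have := (E g).toRealAffineIsometryEquiv.map_vadd 0 f
    simp only [vadd_eq_add, add_zero] at this
    exact this
  have hA' : ∀ g f, A g f = act g f - act g 0 := fun g f => by rw [hA g f]; simp
  have hcont : ∀ f, Continuous fun g => act g f := by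
    intro f
    rw [continuous_iff_continuousAt]
    intro g₀
    rw [ContinuousAt, tendsto_iff_edist_tendsto_0]
    refine (hc f g₀).congr fun g => ?_
    rw [Lp.edist_def, eLpNorm_congr_ae (Lp.coeFn_sub _ _)]
  have hsep : TopologicalSpace.SeparableSpace (Lp ℂ 2 μ) := by
    have : Fact ((2 : ℝ≥0∞) ≠ ∞) := ⟨by simp⟩
    infer_instance
  obtain ⟨Y, mY, ν, hY, hν, β, hβ⟩ := main_action hp A (fun g => act g 0)
    (by ext1 f; rw [hA', h1, h1]; simp) (h1 0)
    (by intro g h; ext1 f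
        simp only [LinearIsometry.coe_comp, Function.comp_apply]
        rw [hA' (g * h), hm, hm, hA g (act h f), hA g (act h 0), hA' h f, map_sub]; abel)
    (by intro g h; rw [hm, hA g (act h 0)])
    (by intro ξ; simp_rw [hA']; exact (hcont ξ).sub (hcont 0)) (hcont 0)
  refine ⟨Y, mY, ν, hY, hν, β, fun g => ?_⟩
  rw [← hβ g, Lp.norm_def, ← ENNReal.toReal_pow,
    ENNReal.ofReal_toReal (ENNReal.pow_ne_top (Lp.eLpNorm_ne_top _))]
  norm_cast
end


theorem stmt5 {G : Type*} [Group G] [TopologicalSpace G] [IsTopologicalGroup G]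
    {p : ℝ} (hp : 2 ≤ p) (ψ : G → NNReal) (hψ : Continuous ψ)
    (h : ∃ (X : Type) (_ : MeasurableSpace X) (μ : Measure X),
      StandardBorelSpace X ∧ SigmaFinite μ ∧
      ∃ α : AffineIsometricAction G μ 2,
        ∀ g : G, (ψ g : ℝ≥0∞) = pPow μ 2 ((α.act g 0 : X →ₘ[μ] ℂ))) :
    ∃ (Y : Type) (_ : MeasurableSpace Y) (ν : Measure Y),
      StandardBorelSpace Y ∧ SigmaFinite ν ∧
      ∃ β : AffineIsometricAction G ν p,
        ∀ g : G, (ψ g : ℝ≥0∞) = pPow ν p ((β.act g 0 : Y →ₘ[ν] ℂ)) := by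
  rcases hp.eq_or_lt with rfl | hp
  · exact h
  obtain ⟨X, mX, μ, hX, hμ, α, hα⟩ := h
  have hroot : ∀ F : X →ₘ[μ] ℂ, eLpNorm F (ENNReal.ofReal 2) μ = (pPow μ 2 F) ^ (1 / 2 : ℝ) := by
    intro F
    rw [pPow_eq μ two_pos, ← ENNReal.rpow_mul]
    norm_num
  obtain ⟨Y, mY, ν, hY, hν, β, hβ⟩ := split_action (q := ENNReal.ofReal 2) (by simp) μ α.act
    α.act_one α.act_mul
    (fun g f f' => by
      rw [hroot, hroot, AddSubgroup.coe_sub, AddSubgroup.coe_sub, α.isometry])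
    (fun f g₀ => by
      simp_rw [hroot, AddSubgroup.coe_sub]
      have := ((ENNReal.continuous_rpow_const (y := 1 / 2)).tendsto 0).comp (α.continuous f g₀)
      simpa [Function.comp_def] using this) hp
  refine ⟨Y, mY, ν, hY, hν, β, fun g => ?_⟩
  rw [← hβ g, hα g, pPow_eq μ two_pos]
end

section
/- Let 0 < p < q < ∞ and let φ : ℂ → ℝ be a nonzero, radial, compactly supported, Lipschitz function. Then there exists a constant C(q) with 0 < C(q) < ∞ such that for every w ∈ ℂ, ∫_ℂ ∫_0^∞ |φ(z + λ^{-1/p} w) − φ(z)|^q dλ dz = C(q) |w|^p, where dz denotes Lebesgue measure on ℂ and dλ denotes Lebesgue measure on (0,∞). -/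
open MeasureTheory

theorem aux_scale (H : ℝ → ENNReal) (hH : Measurable H) {a : ℝ} (ha : 0 < a) :
    ∫⁻ l in Set.Ioi (0:ℝ), H l = ENNReal.ofReal a * ∫⁻ l in Set.Ioi (0:ℝ), H (a * l) := by
  rw [← lintegral_indicator measurableSet_Ioi, ← lintegral_indicator measurableSet_Ioi]
  conv_lhs => rw [← Real.smul_map_volume_mul_left ha.ne']
  rw [lintegral_smul_measure, lintegral_map (hH.indicator measurableSet_Ioi) (by fun_prop),
    abs_of_pos ha, smul_eq_mul]
  congr 2
  ext l
  by_cases hl : 0 < l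
  · simp [Set.indicator, hl, ha]
  · simp [Set.indicator, hl, ha]

/-- the inner translate integral -/
noncomputable def auxG (φ : ℂ → ℝ) (q : ℝ) (v : ℂ) : ENNReal :=
  ∫⁻ z : ℂ, ENNReal.ofReal (|φ (z + v) - φ z| ^ q)

theorem auxG_norm (φ : ℂ → ℝ) (q : ℝ)
    (hr : ∀ z z' : ℂ, ‖z‖ = ‖z'‖ → φ z = φ z') (hm : Measurable φ) (v v' : ℂ) (h : ‖v‖ = ‖v'‖) :
    auxG φ q v = auxG φ q v' := by
  by_cases hv : v = 0
  · subst hv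
    have : v' = 0 := by simpa using h.symm
    rw [this]
  have hv' : v' ≠ 0 := by
    rintro rfl
    simp at h; exact hv h
  have hn : ‖v / v'‖ = 1 := by
    rw [norm_div, h, div_self (norm_ne_zero_iff.2 hv')]
  let u : Circle := ⟨v / v', by simpa [Submonoid.unitSphere] using hn⟩
  have hmp : MeasurePreserving (rotation u) volume volume := (rotation u).measurePreserving
  unfold auxG
  rw [← hmp.lintegral_comp (by fun_prop)]
  refine lintegral_congr fun z => ?_
  have e1 : φ (rotation u z + v) = φ (z + v') := by
    apply hr
    have : rotation u z + v = (v / v') * (z + v') := by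
      rw [rotation_apply]
      change (v / v') * z + v = _
      field_simp
    rw [this, norm_mul, hn, one_mul]
  have e2 : φ (rotation u z) = φ z := hr _ _ ((rotation u).norm_map z)
  rw [e1, e2]

theorem auxG_pos (φ : ℂ → ℝ) {q : ℝ} (hq : 0 < q) (hne : φ ≠ 0) (hc : Continuous φ)
    (hs : HasCompactSupport φ) (v : ℂ) (hv : v ≠ 0) : auxG φ q v ≠ 0 := by
  intro h
  unfold auxG at h
  have hcont : Continuous fun z : ℂ => ENNReal.ofReal (|φ (z + v) - φ z| ^ q) := by
    apply ENNReal.continuous_ofReal.comp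
    exact Continuous.rpow_const (by fun_prop) (fun _ => Or.inr hq.le)
  rw [lintegral_eq_zero_iff hcont.measurable] at h
  have h2 := (Continuous.ae_eq_iff_eq volume hcont continuous_const).1 h
  have hper : Function.Periodic φ v := by
    intro z
    have h3 := congrFun h2 z
    replace h3 := ENNReal.ofReal_eq_zero.1 h3
    have h4 : |φ (z + v) - φ z| ^ q = 0 := le_antisymm h3 (by positivity)
    rw [Real.rpow_eq_zero (abs_nonneg _) hq.ne', abs_eq_zero] at h4
    linarith
  apply hne
  ext z
  obtain ⟨R, hR⟩ := hs.isCompact.isBounded.subset_closedBall 0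
  obtain ⟨n, hn⟩ := exists_nat_gt ((R + ‖z‖) / ‖v‖)
  have hvp : 0 < ‖v‖ := norm_pos_iff.2 hv
  rw [div_lt_iff₀ hvp] at hn
  rw [← hper.nsmul n z]
  by_contra hcon
  have := hR (subset_tsupport _ hcon)
  rw [mem_closedBall_zero_iff] at this
  have h5 : ‖(n : ℂ) * v‖ ≤ ‖z + n • v‖ + ‖z‖ := by
    have := norm_sub_le (z + n • v) z
    simpa using this
  rw [norm_mul, Complex.norm_natCast] at h5
  linarith

theorem auxG_le (φ : ℂ → ℝ) {q : ℝ} (hq : 0 < q)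
    (hs : HasCompactSupport φ) : ∃ V : ENNReal, V ≠ ⊤ ∧ ∀ (v : ℂ) (B : ℝ),
      (∀ z, |φ (z + v) - φ z| ≤ B) → auxG φ q v ≤ ENNReal.ofReal (B ^ q) * V := by
  refine ⟨volume (tsupport φ) + volume (tsupport φ), ?_, ?_⟩
  · have := hs.isCompact.measure_lt_top (μ := (volume : Measure ℂ))
    simp [this.ne]
  intro v B hB
  set S := tsupport φ ∪ (fun z => z + v) ⁻¹' tsupport φ with hS
  have hSm : MeasurableSet S :=
    (isClosed_tsupport φ).measurableSet.union
      ((isClosed_tsupport φ).measurableSet.preimage (by fun_prop))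
  have hSv : volume S ≤ volume (tsupport φ) + volume (tsupport φ) := by
    refine (measure_union_le _ _).trans ?_
    rw [measure_preimage_add_right]
  calc auxG φ q v ≤ ∫⁻ z : ℂ, S.indicator (fun _ => ENNReal.ofReal (B ^ q)) z := by
        refine lintegral_mono fun z => ?_
        by_cases hz : z ∈ S
        · rw [Set.indicator_of_mem hz]
          exact ENNReal.ofReal_le_ofReal (Real.rpow_le_rpow (abs_nonneg _) (hB z) hq.le)
        · rw [Set.indicator_of_notMem hz]
          have h1 : φ z = 0 := image_eq_zero_of_notMem_tsupport fun h => hz (Or.inl h)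
          have h2 : φ (z + v) = 0 := image_eq_zero_of_notMem_tsupport fun h => hz (Or.inr h)
          simp [h1, h2, Real.zero_rpow hq.ne']
    _ = ENNReal.ofReal (B ^ q) * volume S := lintegral_indicator_const hSm _
    _ ≤ _ := by gcongr

theorem stmt7 {p q : ℝ} (hp : 0 < p) (hpq : p < q)
    (φ : ℂ → ℝ) (hφ_ne : φ ≠ 0)
    (hφ_radial : ∀ z z' : ℂ, ‖z‖ = ‖z'‖ → φ z = φ z')
    (hφ_supp : HasCompactSupport φ)
    (hφ_lip : ∃ K : NNReal, LipschitzWith K φ) :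
    ∃ C : ℝ, 0 < C ∧ ∀ w : ℂ,
      ∫⁻ z : ℂ, ∫⁻ l in Set.Ioi (0 : ℝ),
          ENNReal.ofReal (|φ (z + (l ^ (-p⁻¹) : ℝ) • w) - φ z| ^ q)
        = ENNReal.ofReal (C * ‖w‖ ^ p) := by
  obtain ⟨K, hK⟩ := hφ_lip
  have hq : 0 < q := hp.trans hpq
  have hc := hK.continuous
  have hm := hc.measurable
  have hGm : Measurable (auxG φ q) := by
    unfold auxG
    apply Measurable.lintegral_prod_right' (f := fun x : ℂ × ℂ =>
      ENNReal.ofReal (|φ (x.2 + x.1) - φ x.2| ^ q))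
    fun_prop
  have hHm : ∀ w : ℂ, Measurable fun l : ℝ => auxG φ q ((l ^ (-p⁻¹) : ℝ) • w) :=
    fun w => hGm.comp (by fun_prop)
  have hswap : ∀ w : ℂ, ∫⁻ z : ℂ, ∫⁻ l in Set.Ioi (0 : ℝ),
          ENNReal.ofReal (|φ (z + (l ^ (-p⁻¹) : ℝ) • w) - φ z| ^ q)
        = ∫⁻ l in Set.Ioi (0 : ℝ), auxG φ q ((l ^ (-p⁻¹) : ℝ) • w) := by
    intro w
    rw [lintegral_lintegral_swap]
    · rfl
    · apply Measurable.aemeasurable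
      unfold Function.uncurry
      fun_prop
  set I := ∫⁻ l in Set.Ioi (0 : ℝ), auxG φ q ((l ^ (-p⁻¹) : ℝ) • (1:ℂ)) with hI
  have hIpos : I ≠ 0 := by
    intro h
    rw [hI, lintegral_eq_zero_iff (hHm 1)] at h
    have h' := (ae_restrict_iff' measurableSet_Ioi).1 h
    have : ∀ᵐ l : ℝ, l ∉ Set.Ioi (0:ℝ) := by
      filter_upwards [h'] with l hl hl0
      refine auxG_pos φ hq hφ_ne hc hφ_supp _ ?_ (hl hl0)
      simpa using (Real.rpow_pos_of_pos hl0 _).ne'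
    rw [ae_iff] at this
    have h0 : volume (Set.Ioi (0:ℝ)) = 0 := by simpa [Set.Ioi] using this
    rw [Real.volume_Ioi] at h0
    exact ENNReal.top_ne_zero h0
  have hItop : I ≠ ⊤ := by
    obtain ⟨V, hV, hVb⟩ := auxG_le φ hq hφ_supp
    obtain ⟨M, hM⟩ := hc.bounded_above_of_compact_support hφ_supp
    rw [hI, ← Set.Ioc_union_Ioi_eq_Ioi (zero_le_one (α := ℝ))]
    refine ne_top_of_le_ne_top ?_ (lintegral_union_le _ _ _)
    refine ENNReal.add_ne_top.2 ⟨?_, ?_⟩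
    · refine ne_top_of_le_ne_top (b := ∫⁻ l in Set.Ioc (0:ℝ) 1, ENNReal.ofReal ((M + M) ^ q) * V)
        ?_ (lintegral_mono fun l => hVb _ _ fun z => ?_)
      · rw [setLIntegral_const]
        simp [ENNReal.mul_eq_top, hV]
      · exact (norm_sub_le _ _).trans (add_le_add (hM _) (hM _))
    · have hint : IntegrableOn (fun l : ℝ => K ^ q * l ^ (-(q / p))) (Set.Ioi 1) := by
        apply Integrable.const_mul
        apply integrableOn_Ioi_rpow_of_lt _ one_pos
        have : 1 < q / p := (one_lt_div hp).2 hpq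
        linarith
      refine ne_top_of_le_ne_top (b := ∫⁻ l in Set.Ioi (1:ℝ),
        ENNReal.ofReal (K ^ q * l ^ (-(q / p))) * V) ?_ ?_
      · rw [lintegral_mul_const' _ _ hV]
        exact ENNReal.mul_ne_top hint.lintegral_lt_top.ne hV
      · refine setLIntegral_mono' measurableSet_Ioi fun l hl => ?_
        have hl0 : (0:ℝ) < l := one_pos.trans hl
        have hlp := Real.rpow_pos_of_pos hl0 (-p⁻¹)
        refine (hVb _ (K * l ^ (-p⁻¹)) fun z => ?_).trans_eq ?_
        · have := hK.dist_le_mul (z + (l ^ (-p⁻¹) : ℝ) • (1:ℂ)) z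
          rw [Real.dist_eq, dist_eq_norm, add_sub_cancel_left, norm_smul, norm_one, mul_one,
            Real.norm_of_nonneg hlp.le] at this
          exact this
        · rw [Real.mul_rpow K.coe_nonneg hlp.le, ← Real.rpow_mul hl0.le]
          congr 4
          field_simp
  refine ⟨I.toReal, ENNReal.toReal_pos hIpos hItop, fun w => ?_⟩
  rw [hswap]
  by_cases hw : w = 0
  · subst hw
    simp [auxG, Real.zero_rpow hp.ne', Real.zero_rpow hq.ne']
  have hwp : 0 < ‖w‖ := norm_pos_iff.2 hw
  have hap := Real.rpow_pos_of_pos hwp p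
  rw [aux_scale _ (hHm w) hap, ENNReal.ofReal_mul ENNReal.toReal_nonneg,
    ENNReal.ofReal_toReal hItop, mul_comm I]
  congr 1
  refine setLIntegral_congr_fun measurableSet_Ioi fun l hl => ?_
  have hl0 : (0:ℝ) < l := hl
  refine auxG_norm φ q hφ_radial hm _ _ ?_
  rw [norm_smul, norm_smul, norm_one, Real.mul_rpow hap.le hl0.le, ← Real.rpow_mul hwp.le,
    mul_neg, mul_inv_cancel₀ hp.ne', Real.rpow_neg_one, norm_mul, norm_inv, norm_norm]
  field_simp
end

section
/- For every 1 ≤ p ≤ q < ∞ there exists a constant c = c(p,q) such that for all complex numbers a, b: |sign(a)|a|^{p/q} − sign(b)|b|^{p/q}| ≤ c |a − b|^{p/q}. -/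
/-- `sign z = z/|z|` for `z ≠ 0`, and `sign 0 = 0`. -/
noncomputable def csign (z : ℂ) : ℂ := if z = 0 then 0 else z / (‖z‖ : ℝ)

/-- The pointwise Mazur map `z ↦ sign(z) |z|^r`. -/
noncomputable def mazur (r : ℝ) (z : ℂ) : ℂ := csign z * ((‖z‖ ^ r : ℝ) : ℂ)

theorem mazur_eq (r : ℝ) (z : ℂ) : mazur r z = z * ((‖z‖ ^ (r - 1) : ℝ) : ℂ) := by
  unfold mazur csign
  by_cases h : z = 0
  · simp [h]
  · have hz : ‖z‖ ≠ 0 := norm_ne_zero_iff.mpr h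
    have hz' : ((‖z‖ : ℝ) : ℂ) ≠ 0 := by exact_mod_cast hz
    rw [if_neg h, Real.rpow_sub_one hz]
    push_cast
    field_simp

theorem norm_mazur {r : ℝ} (hr : 0 < r) (z : ℂ) : ‖mazur r z‖ = ‖z‖ ^ r := by
  by_cases h : z = 0
  · simp [h, mazur, csign, Real.zero_rpow hr.ne']
  · have hz : ‖z‖ ≠ 0 := norm_ne_zero_iff.mpr h
    rw [mazur_eq, norm_mul, Complex.norm_real, Real.norm_of_nonneg (by positivity),
      Real.rpow_sub_one hz]
    field_simp

theorem mazur_aux {r : ℝ} (hr : 0 < r) (hr1 : r ≤ 1) (a b : ℂ) (hab : ‖b‖ ≤ ‖a‖) :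
    ‖mazur r a - mazur r b‖ ≤ 2 * ‖a - b‖ ^ r := by
  by_cases hA : ‖a‖ ≤ ‖a - b‖
  · have h1 := norm_sub_le (mazur r a) (mazur r b)
    rw [norm_mazur hr, norm_mazur hr] at h1
    have h2 : ‖a‖ ^ r ≤ ‖a - b‖ ^ r := Real.rpow_le_rpow (norm_nonneg _) hA hr.le
    have h3 : ‖b‖ ^ r ≤ ‖a‖ ^ r := Real.rpow_le_rpow (norm_nonneg _) hab hr.le
    linarith
  · push Not at hA
    by_cases hd : a = b
    · subst hd
      simp [Real.zero_rpow hr.ne']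
    have hd0 : 0 < ‖a - b‖ := norm_pos_iff.mpr (sub_ne_zero.mpr hd)
    have htri : ‖a‖ - ‖b‖ ≤ ‖a - b‖ := norm_sub_norm_le a b
    have hB : 0 < ‖b‖ := by linarith
    have hA0 : 0 < ‖a‖ := by linarith
    have e : mazur r a - mazur r b = (a - b) * ((‖a‖ ^ (r - 1) : ℝ) : ℂ)
        + b * ((‖a‖ ^ (r - 1) - ‖b‖ ^ (r - 1) : ℝ) : ℂ) := by
      rw [mazur_eq, mazur_eq]; push_cast; ring
    have hmono : ‖a‖ ^ (r - 1) ≤ ‖b‖ ^ (r - 1) :=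
      Real.rpow_le_rpow_of_nonpos hB hab (by linarith)
    have hmono2 : ‖a‖ ^ (r - 1) ≤ ‖a - b‖ ^ (r - 1) :=
      Real.rpow_le_rpow_of_nonpos hd0 hA.le (by linarith)
    have key : ∀ x : ℝ, 0 < x → x * x ^ (r - 1) = x ^ r := by
      intro x hx
      rw [Real.rpow_sub_one hx.ne']; field_simp
    have hP : 0 ≤ ‖a‖ ^ (r - 1) := by positivity
    have h3 : ‖b‖ ^ r ≤ ‖a‖ ^ r := Real.rpow_le_rpow (norm_nonneg _) hab hr.le
    have k1 := key _ hA0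
    have k2 := key _ hB
    have k3 := key _ hd0
    have h4 : ‖a - b‖ * ‖a‖ ^ (r - 1) ≤ ‖a - b‖ ^ r := by
      rw [← k3]; gcongr
    have h5 := mul_le_mul_of_nonneg_right htri hP
    rw [e]
    refine (norm_add_le _ _).trans ?_
    rw [norm_mul, norm_mul, Complex.norm_real, Complex.norm_real, Real.norm_of_nonneg hP,
      Real.norm_of_nonpos (by linarith)]
    nlinarith

/-- For every `1 ≤ p ≤ q < ∞` there is a constant `c = c(p,q)` such that for all
complex numbers `a, b`: `|sign(a)|a|^{p/q} − sign(b)|b|^{p/q}| ≤ c |a − b|^{p/q}`. -/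
theorem stmt9 {p q : ℝ} (hp : 1 ≤ p) (hpq : p ≤ q) :
    ∃ c : ℝ, ∀ a b : ℂ,
      ‖mazur (p / q) a - mazur (p / q) b‖ ≤ c * ‖a - b‖ ^ (p / q) := by
  have hq : 0 < q := by linarith
  have hr : 0 < p / q := div_pos (by linarith) hq
  have hr1 : p / q ≤ 1 := (div_le_one hq).mpr hpq
  refine ⟨2, fun a b => ?_⟩
  rcases le_total ‖b‖ ‖a‖ with h | h
  · exact mazur_aux hr hr1 a b h
  · rw [norm_sub_rev, norm_sub_rev a b]
    exact mazur_aux hr hr1 b a h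
end

section
/- For every 1 ≤ p ≤ q < ∞ there exists a constant c = c(p,q) such that for all complex numbers a, b: |a − b| ≤ c ( |sign(a)|a|^{p/q} − sign(b)|b|^{p/q}|^{q/p} + |a|^{1 − p/q} · |sign(a)|a|^{p/q} − sign(b)|b|^{p/q}| ). -/
lemma rpow_sub_le_aux {s x y : ℝ} (hs : 1 ≤ s) (hy : 0 ≤ y) (hxy : y ≤ x) :
    x ^ s - y ^ s ≤ s * x ^ (s - 1) * (x - y) := by
  rcases (hy.trans hxy).eq_or_lt with h | hx
  · subst h
    have : y = 0 := le_antisymm hxy hy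
    subst this
    simp
  have h1 := one_add_mul_self_le_rpow_one_add (s := y / x - 1) (p := s)
    (by have : 0 ≤ y / x := by positivity
        linarith) hs
  rw [add_sub_cancel, Real.div_rpow hy hx.le, le_div_iff₀ (by positivity)] at h1
  have h2 : x ^ s = x ^ (s - 1) * x := by
    rw [← Real.rpow_add_one hx.ne', sub_add_cancel]
  have h3 : (1 + s * (y / x - 1)) * x ^ s = x ^ s - s * x ^ (s - 1) * (x - y) := by
    rw [h2]; field_simp; ring
  linarith

lemma abs_rpow_sub_le_aux {s x y d : ℝ} (hs : 1 ≤ s) (hx : 0 ≤ x) (hy : 0 ≤ y)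
    (hd : |x - y| ≤ d) :
    |x ^ s - y ^ s| ≤ s * (x + d) ^ (s - 1) * d := by
  have hd0 : 0 ≤ d := (abs_nonneg _).trans hd
  have hs1 : 0 ≤ s - 1 := by linarith
  obtain ⟨hd1, hd2⟩ := abs_le.1 hd
  rcases le_total y x with h | h
  · rw [abs_of_nonneg (sub_nonneg.2 (Real.rpow_le_rpow hy h (by linarith)))]
    refine (rpow_sub_le_aux hs hy h).trans ?_
    have : x ^ (s - 1) ≤ (x + d) ^ (s - 1) := Real.rpow_le_rpow hx (by linarith) hs1
    have : 0 ≤ x - y := by linarith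
    gcongr
  · rw [abs_sub_comm, abs_of_nonneg (sub_nonneg.2 (Real.rpow_le_rpow hx h (by linarith)))]
    refine (rpow_sub_le_aux hs hx h).trans ?_
    have : y ^ (s - 1) ≤ (x + d) ^ (s - 1) := Real.rpow_le_rpow hy (by linarith) hs1
    have : 0 ≤ y - x := by linarith
    have : y - x ≤ d := by linarith
    gcongr

lemma add_rpow_aux {t x d : ℝ} (ht : 0 ≤ t) (hx : 0 ≤ x) (hd : 0 ≤ d) :
    (x + d) ^ t ≤ 2 ^ t * (x ^ t + d ^ t) := by
  have hx' := Real.rpow_nonneg hx t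
  have hd' := Real.rpow_nonneg hd t
  rcases le_total d x with h | h
  · calc (x + d) ^ t ≤ (2 * x) ^ t := Real.rpow_le_rpow (by positivity) (by linarith) ht
      _ = 2 ^ t * x ^ t := Real.mul_rpow (by norm_num) hx
      _ ≤ _ := by gcongr; linarith
  · calc (x + d) ^ t ≤ (2 * d) ^ t := Real.rpow_le_rpow (by positivity) (by linarith) ht
      _ = 2 ^ t * d ^ t := Real.mul_rpow (by norm_num) hd
      _ ≤ _ := by gcongr; linarith

lemma norm_mazur_aux {r : ℝ} (hr : 0 < r) (a : ℂ) : ‖mazur r a‖ = ‖a‖ ^ r := by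
  unfold mazur csign
  by_cases h : a = 0
  · simp [h, Real.zero_rpow hr.ne']
  · have : ‖a‖ ≠ 0 := by simpa using h
    rw [if_neg h, norm_mul, norm_div, Complex.norm_real, Complex.norm_real, norm_norm,
      div_self this, one_mul, Real.norm_of_nonneg (by positivity)]

lemma mazur_inv_aux {r : ℝ} (a : ℂ) :
    ((‖a‖ ^ (1 - r) : ℝ) : ℂ) * mazur r a = a := by
  unfold mazur csign
  by_cases h : a = 0
  · simp [h]
  · have h0 : 0 < ‖a‖ := by simpa using h
    have h1 : (‖a‖ : ℂ) ≠ 0 := by exact_mod_cast h0.ne'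
    have h2 : ((‖a‖ ^ (1 - r) : ℝ) : ℂ) * ((‖a‖ ^ r : ℝ) : ℂ) = (‖a‖ : ℂ) := by
      rw [← Complex.ofReal_mul, ← Real.rpow_add h0]; simp
    rw [if_neg h, mul_left_comm, h2]
    field_simp

lemma core_aux {s : ℝ} (hs : 1 ≤ s) (u v : ℂ) :
    ‖((‖u‖ ^ (s - 1) : ℝ) : ℂ) * u - ((‖v‖ ^ (s - 1) : ℝ) : ℂ) * v‖ ≤
      (2 + s * 2 ^ (s - 1)) * (‖u - v‖ ^ s + ‖u‖ ^ (s - 1) * ‖u - v‖) := by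
  have hx := norm_nonneg u
  have hy := norm_nonneg v
  have hd := norm_nonneg (u - v)
  have hxy := abs_norm_sub_norm_le u v
  have hpw : ∀ z : ℝ, 0 ≤ z → z ^ s = z ^ (s - 1) * z := fun z hz => by
    rw [← Real.rpow_add_one' hz (by linarith), sub_add_cancel]
  have h1 := abs_rpow_sub_le_aux hs hx hy hxy
  have h2 := add_rpow_aux (sub_nonneg.2 hs) hx hd
  have e : ((‖u‖ ^ (s - 1) : ℝ) : ℂ) * u - ((‖v‖ ^ (s - 1) : ℝ) : ℂ) * v
      = ((‖u‖ ^ (s - 1) : ℝ) : ℂ) * (u - v) + ((‖u‖ ^ (s - 1) - ‖v‖ ^ (s - 1) : ℝ) : ℂ) * v := by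
    push_cast; ring
  have h3 : ‖((‖u‖ ^ (s - 1) - ‖v‖ ^ (s - 1) : ℝ) : ℂ) * v‖ ≤
      ‖u‖ ^ (s - 1) * ‖u - v‖ + |‖u‖ ^ s - ‖v‖ ^ s| := by
    rw [norm_mul, Complex.norm_real, Real.norm_eq_abs]
    nth_rewrite 2 [← abs_of_nonneg hy]
    rw [← abs_mul]
    have e2 : (‖u‖ ^ (s - 1) - ‖v‖ ^ (s - 1)) * ‖v‖
        = - (‖u‖ ^ (s - 1) * (‖u‖ - ‖v‖)) + (‖u‖ ^ s - ‖v‖ ^ s) := by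
      rw [hpw _ hx, hpw _ hy]; ring
    rw [e2]
    refine (abs_add_le _ _).trans ?_
    rw [abs_neg, abs_mul, abs_of_nonneg (Real.rpow_nonneg hx _)]
    gcongr
  have h4 : ‖((‖u‖ ^ (s - 1) : ℝ) : ℂ) * (u - v)‖ = ‖u‖ ^ (s - 1) * ‖u - v‖ := by
    rw [norm_mul, Complex.norm_real, Real.norm_of_nonneg (Real.rpow_nonneg hx _)]
  rw [e]
  refine (norm_add_le _ _).trans ?_
  rw [h4]
  have h5 : s * (‖u‖ + ‖u - v‖) ^ (s - 1) * ‖u - v‖ ≤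
      s * (2 ^ (s - 1) * (‖u‖ ^ (s - 1) + ‖u - v‖ ^ (s - 1))) * ‖u - v‖ := by
    gcongr
  have h6 := Real.rpow_nonneg hd s
  have h7 := hpw _ hd
  have h8 : s * (2 ^ (s - 1) * (‖u‖ ^ (s - 1) + ‖u - v‖ ^ (s - 1))) * ‖u - v‖
     = s * 2 ^ (s - 1) * (‖u - v‖ ^ s + ‖u‖ ^ (s - 1) * ‖u - v‖) := by
    rw [h7]; ring
  linarith

/-- For every `1 ≤ p ≤ q < ∞` there is a constant `c = c(p,q)` such that for all
complex numbers `a, b`: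
`|a − b| ≤ c (|sign(a)|a|^{p/q} − sign(b)|b|^{p/q}|^{q/p}
             + |a|^{1−p/q} |sign(a)|a|^{p/q} − sign(b)|b|^{p/q}|)`. -/
theorem stmt10 {p q : ℝ} (hp : 1 ≤ p) (hpq : p ≤ q) :
    ∃ c : ℝ, ∀ a b : ℂ,
      ‖a - b‖ ≤
        c * (‖mazur (p / q) a - mazur (p / q) b‖ ^ (q / p)
          + ‖a‖ ^ (1 - p / q) * ‖mazur (p / q) a - mazur (p / q) b‖) := by
  have hp0 : 0 < p := by linarith
  have hq0 : 0 < q := by linarith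
  have hr : 0 < p / q := by positivity
  have hs : 1 ≤ q / p := by rwa [le_div_iff₀ hp0, one_mul]
  refine ⟨2 + q / p * 2 ^ (q / p - 1), fun a b => ?_⟩
  have key : ∀ z : ℂ, ‖mazur (p / q) z‖ ^ (q / p - 1) = ‖z‖ ^ (1 - p / q) := fun z => by
    rw [norm_mazur_aux hr, ← Real.rpow_mul (norm_nonneg z)]
    congr 1
    field_simp
  have h := core_aux hs (mazur (p / q) a) (mazur (p / q) b)
  rwa [key, key, mazur_inv_aux, mazur_inv_aux] at h
end

section
/- Let 1 ≤ p ≤ q < ∞ and let (X,μ) be a σ-finite measure space. If f, g : X → ℂ are measurable functions such that f − g ∈ L_p(X,μ), then M_{p,q}(f) − M_{p,q}(g) ∈ L_q(X,μ); moreover ‖M_{p,q}(f) − M_{p,q}(g)‖_{L_q} ≤ c ‖f − g‖_{L_p}^{p/q}, where c = c(p,q) is a constant depending only on p and q. -/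
open MeasureTheory

universe u

theorem csign_mul_norm (z : ℂ) : csign z * (‖z‖ : ℝ) = z := by
  unfold csign
  split_ifs with h
  · simp [h]
  · have : ((‖z‖ : ℝ) : ℂ) ≠ 0 := by exact_mod_cast norm_ne_zero_iff.mpr h
    field_simp

theorem norm_csign_le (z : ℂ) : ‖csign z‖ ≤ 1 := by
  unfold csign
  split_ifs with h
  · simp
  · have : ‖z‖ ≠ 0 := norm_ne_zero_iff.mpr h
    simp [this]

theorem rpow_norm_sub_le {r : ℝ} (h0 : 0 < r) (h1 : r ≤ 1) (z w : ℂ) :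
    ‖z‖ ^ r - ‖w‖ ^ r ≤ ‖z - w‖ ^ r := by
  have h2 : ‖z‖ ≤ ‖w‖ + ‖z - w‖ := by
    have := norm_sub_norm_le z w
    linarith
  have h3 := Real.rpow_le_rpow (norm_nonneg z) h2 h0.le
  have h4 := Real.rpow_add_le_add_rpow (norm_nonneg w) (norm_nonneg (z - w)) h0.le h1
  linarith

theorem mazur_holder {r : ℝ} (h0 : 0 < r) (h1 : r ≤ 1) (z w : ℂ) :
    ‖mazur r z - mazur r w‖ ≤ 3 * ‖z - w‖ ^ r := by
  have e : mazur r z - mazur r w = csign z * ((‖z‖ ^ r - ‖w‖ ^ r : ℝ) : ℂ)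
      + (csign z - csign w) * ((‖w‖ ^ r : ℝ) : ℂ) := by
    unfold mazur; push_cast; ring
  have a1 : |‖z‖ ^ r - ‖w‖ ^ r| ≤ ‖z - w‖ ^ r := by
    rw [abs_le]
    have h2 := rpow_norm_sub_le h0 h1 w z
    rw [norm_sub_rev] at h2
    exact ⟨by linarith, rpow_norm_sub_le h0 h1 z w⟩
  have a2 : ‖csign z * ((‖z‖ ^ r - ‖w‖ ^ r : ℝ) : ℂ)‖ ≤ ‖z - w‖ ^ r := by
    rw [norm_mul, Complex.norm_real, Real.norm_eq_abs]
    have := mul_le_mul (norm_csign_le z) a1 (abs_nonneg _) zero_le_one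
    linarith
  have b1 : ‖csign z - csign w‖ ≤ 2 := by
    have := norm_sub_le (csign z) (csign w)
    linarith [norm_csign_le z, norm_csign_le w]
  have b2 : ‖csign z - csign w‖ * ‖w‖ ≤ 2 * ‖z - w‖ := by
    have e2 : (csign z - csign w) * (‖w‖ : ℝ) =
        (z - w) + csign z * ((‖w‖ - ‖z‖ : ℝ) : ℂ) := by
      push_cast
      linear_combination csign_mul_norm z - csign_mul_norm w
    have e3 : ‖csign z - csign w‖ * ‖w‖ = ‖(csign z - csign w) * (‖w‖ : ℝ)‖ := by
      simp
    rw [e3, e2]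
    refine (norm_add_le _ _).trans ?_
    have h3 : ‖csign z * ((‖w‖ - ‖z‖ : ℝ) : ℂ)‖ ≤ ‖z - w‖ := by
      rw [norm_mul, Complex.norm_real, Real.norm_eq_abs]
      have h4 := abs_norm_sub_norm_le w z
      rw [norm_sub_rev] at h4
      have := mul_le_mul (norm_csign_le z) h4 (abs_nonneg _) zero_le_one
      linarith
    linarith
  have b3 : ‖(csign z - csign w) * ((‖w‖ ^ r : ℝ) : ℂ)‖ ≤ 2 * ‖z - w‖ ^ r := by
    rw [norm_mul, Complex.norm_real, Real.norm_of_nonneg (by positivity)]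
    have split : ∀ a : ℝ, 0 ≤ a → a ^ (1 - r) * a ^ r = a := by
      intro a ha
      rw [← Real.rpow_add_of_nonneg ha (by linarith) h0.le]
      simp
    set a := ‖csign z - csign w‖
    have ha : 0 ≤ a := norm_nonneg _
    calc a * ‖w‖ ^ r = a ^ (1 - r) * (a * ‖w‖) ^ r := by
          rw [Real.mul_rpow ha (norm_nonneg _), ← mul_assoc, split a ha]
      _ ≤ 2 ^ (1 - r) * (2 * ‖z - w‖) ^ r := by
          apply mul_le_mul
          · exact Real.rpow_le_rpow ha b1 (by linarith)
          · exact Real.rpow_le_rpow (by positivity) b2 h0.le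
          · positivity
          · positivity
      _ = 2 * ‖z - w‖ ^ r := by
          rw [Real.mul_rpow (by norm_num) (norm_nonneg _), ← mul_assoc, split 2 (by norm_num)]
  rw [e]
  refine (norm_add_le _ _).trans ?_
  linarith

theorem measurable_mazur (r : ℝ) : Measurable (mazur r) := by
  unfold mazur csign
  refine Measurable.mul (Measurable.ite (measurableSet_singleton 0) measurable_const ?_) ?_
  · fun_prop
  · fun_prop

/-- **Lemma.** Let `1 ≤ p ≤ q < ∞`.  There is a constant `c = c(p,q)`, depending only
on `p` and `q`, such that for every σ-finite measure space `(X,μ)` and all measurable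
`f, g : X → ℂ` with `f − g ∈ L_p(X,μ)`, one has
`M_{p,q}(f) − M_{p,q}(g) ∈ L_q(X,μ)` and
`‖M_{p,q}(f) − M_{p,q}(g)‖_{L_q} ≤ c ‖f − g‖_{L_p}^{p/q}`. -/
theorem stmt12 {p q : ℝ} (hp : 1 ≤ p) (hpq : p ≤ q) :
    ∃ c : ℝ,
      ∀ (X : Type u) [MeasurableSpace X] (μ : Measure X) [SigmaFinite μ]
        (f g : X → ℂ), Measurable f → Measurable g →
        MemLp (f - g) (ENNReal.ofReal p) μ →
        MemLp (fun x => mazur (p / q) (f x) - mazur (p / q) (g x)) (ENNReal.ofReal q) μ ∧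
          eLpNorm (fun x => mazur (p / q) (f x) - mazur (p / q) (g x)) (ENNReal.ofReal q) μ ≤
            ENNReal.ofReal c * (eLpNorm (f - g) (ENNReal.ofReal p) μ) ^ (p / q) := by
  have hq : 0 < q := by linarith
  have h0 : 0 < p / q := by positivity
  have h1 : p / q ≤ 1 := (div_le_one hq).2 hpq
  refine ⟨3, ?_⟩
  intro X _ μ _ f g hf hg hfg
  have key : eLpNorm (fun x => mazur (p / q) (f x) - mazur (p / q) (g x)) (ENNReal.ofReal q) μ ≤
      ENNReal.ofReal 3 * (eLpNorm (f - g) (ENNReal.ofReal p) μ) ^ (p / q) := by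
    have e1 := eLpNorm_norm_rpow (μ := μ) (p := ENNReal.ofReal q) (f - g) h0
    rw [← ENNReal.ofReal_mul hq.le, mul_div_cancel₀ _ hq.ne'] at e1
    rw [← e1]
    refine eLpNorm_le_mul_eLpNorm_of_ae_le_mul (Filter.Eventually.of_forall fun x => ?_) _
    rw [Real.norm_of_nonneg (by positivity)]
    exact mazur_holder h0 h1 (f x) (g x)
  refine ⟨⟨?_, key.trans_lt ?_⟩, key⟩
  · exact (((measurable_mazur _).comp hf).sub ((measurable_mazur _).comp hg)).aestronglyMeasurable
  · exact ENNReal.mul_lt_top ENNReal.ofReal_lt_top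
      (ENNReal.rpow_lt_top_of_nonneg h0.le hfg.2.ne)
end

section
/- Let 1 ≤ p < q < ∞. Let G be a group, (X,μ) a σ-finite standard measure space, θ a nonsingular action of G on (X,μ) (each θ_g preserves the measure class of μ), and ω : G → L_0(X,μ;𝕋) a map with values in the measurable functions to the circle group 𝕋 satisfying the cocycle identity ω(gh) = ω(g) · (ω(h)∘θ_g^{-1}) for all g, h ∈ G. For 0 < r < ∞ define the linear isometric representation π^{r}(g) on L_0(X,μ) by π^{r}(g)f = (d((θ_g)_*μ)/dμ)^{1/r} · ω(g) · (f∘θ_g^{-1}). Assume that for every f ∈ L_0(X,μ) the following holds: if π^{q}(g)f − f ∈ L_q(X,μ) for all g ∈ G, then there exists h ∈ L_q(X,μ) such that π^{q}(g)f − f = π^{q}(g)h − h for all g ∈ G. Then the analogous statement holds with p in place of q: for every f ∈ L_0(X,μ), if π^{p}(g)f − f ∈ L_p(X,μ) for all g ∈ G, then there exists h ∈ L_p(X,μ) such that π^{p}(g)f − f = π^{p}(g)h − h for all g ∈ G. -/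
open MeasureTheory

/-- The linear isometric representation `π^r` of `G` on `L_r(X,μ)` (and on `L_0(X,μ)`)
associated with a nonsingular action `θ` and a `𝕋`-valued cocycle `ω`:
`π^r(g) f = (d((θ_g)_*μ)/dμ)^{1/r} · ω(g) · (f ∘ θ_g⁻¹)`. -/
noncomputable def piRep {X : Type*} [MeasurableSpace X] (μ : Measure X) {G : Type*} [Group G]
    (θ : G → X → X) (ω : G → X → ℂ) (r : ℝ) (g : G) (f : X → ℂ) : X → ℂ :=
  fun x => ((((μ.map (θ g)).rnDeriv μ x).toReal ^ r⁻¹ : ℝ) : ℂ) * ω g x * f (θ g⁻¹ x)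

/-- The Mazur map `z ↦ z |z|^(a-1)`. -/
noncomputable def mz (a : ℝ) (z : ℂ) : ℂ := ((‖z‖ ^ (a - 1) : ℝ) : ℂ) * z

/-- The real Mazur map. -/
noncomputable def sp (a : ℝ) (v : ℝ) : ℝ := |v| ^ (a - 1) * v

lemma mz_measurable (a : ℝ) : Measurable (mz a) := by unfold mz; fun_prop

lemma sp_measurable (a : ℝ) : Measurable (sp a) := by
  unfold sp
  have : Measurable fun v : ℝ => |v| := measurable_norm
  fun_prop

lemma mz_ofReal (a v : ℝ) : mz a (v : ℂ) = (sp a v : ℂ) := by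
  simp [mz, sp]

lemma mz_zero (a : ℝ) : mz a 0 = 0 := by simp [mz]

lemma norm_mz {a : ℝ} (ha : 0 < a) (z : ℂ) : ‖mz a z‖ = ‖z‖ ^ a := by
  rcases eq_or_ne z 0 with rfl | hz
  · simp [mz, Real.zero_rpow ha.ne']
  · have h : 0 < ‖z‖ := norm_pos_iff.2 hz
    rw [mz, norm_mul, Complex.norm_real, Real.norm_of_nonneg (by positivity),
      Real.rpow_sub_one h.ne']
    field_simp

lemma abs_sp {a : ℝ} (ha : 0 < a) (v : ℝ) : |sp a v| = |v| ^ a := by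
  have := norm_mz ha (v : ℂ)
  rw [mz_ofReal] at this
  simpa using this

lemma mz_mul (a : ℝ) (z w : ℂ) : mz a (z * w) = mz a z * mz a w := by
  rw [mz, norm_mul, Real.mul_rpow (norm_nonneg _) (norm_nonneg _), mz, mz]
  push_cast; ring

lemma mz_one (a : ℝ) : mz a 1 = 1 := by simp [mz]

lemma mz_circ (a : ℝ) {z : ℂ} (hz : ‖z‖ = 1) : mz a z = z := by simp [mz, hz]

lemma mz_pos (a : ℝ) {t : ℝ} (ht : 0 < t) : mz a (t : ℂ) = ((t ^ a : ℝ) : ℂ) := by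
  rw [mz_ofReal, sp, abs_of_pos ht, Real.rpow_sub_one ht.ne']
  field_simp

lemma mz_mz {a b : ℝ} (ha : 0 < a) (hab : a * b = 1) (z : ℂ) : mz b (mz a z) = z := by
  rcases eq_or_ne z 0 with rfl | hz
  · simp [mz_zero]
  have h : 0 < ‖z‖ := norm_pos_iff.2 hz
  rw [mz, norm_mz ha, ← Real.rpow_mul h.le, mz, ← mul_assoc, ← Complex.ofReal_mul,
    ← Real.rpow_add h]
  have : a * (b - 1) + (a - 1) = 0 := by linarith
  simp [this]

lemma mz_holder_aux {a : ℝ} (ha : 0 < a) (ha1 : a < 1) {x y : ℂ} (hxy : ‖y‖ ≤ ‖x‖) :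
    ‖mz a x - mz a y‖ ≤ 3 * ‖x - y‖ ^ a := by
  rcases eq_or_ne y 0 with rfl | hy
  · rw [mz_zero, sub_zero, sub_zero, norm_mz ha]
    have : 0 ≤ ‖x‖ ^ a := by positivity
    linarith
  rcases eq_or_ne x y with rfl | hne
  · simp [Real.zero_rpow ha.ne']
  have hy0 : 0 < ‖y‖ := norm_pos_iff.2 hy
  have hx0 : 0 < ‖x‖ := hy0.trans_le hxy
  have hd : 0 < ‖x - y‖ := norm_pos_iff.2 (sub_ne_zero.2 hne)
  have hd2 : ‖x - y‖ ≤ 2 * ‖x‖ := (norm_sub_le x y).trans (by linarith)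
  have e : mz a x - mz a y = ((‖x‖ ^ (a - 1) : ℝ) : ℂ) * (x - y)
      + ((‖x‖ ^ (a - 1) - ‖y‖ ^ (a - 1) : ℝ) : ℂ) * y := by
    unfold mz; push_cast; ring
  have h1 : ‖((‖x‖ ^ (a - 1) : ℝ) : ℂ) * (x - y)‖ ≤ 2 * ‖x - y‖ ^ a := by
    rw [norm_mul, Complex.norm_real, Real.norm_of_nonneg (by positivity)]
    have h2 : ‖x‖ ^ (a - 1) ≤ (‖x - y‖ / 2) ^ (a - 1) :=
      Real.rpow_le_rpow_of_nonpos (by positivity) (by linarith) (by linarith)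
    have h3 : (‖x - y‖ / 2) ^ (a - 1) * ‖x - y‖ = 2 * (‖x - y‖ / 2) ^ a := by
      rw [Real.rpow_sub_one (by positivity)]; field_simp
    have h4 : (‖x - y‖ / 2) ^ a ≤ ‖x - y‖ ^ a :=
      Real.rpow_le_rpow (by positivity) (by linarith) ha.le
    calc _ ≤ (‖x - y‖ / 2) ^ (a - 1) * ‖x - y‖ := by gcongr
      _ ≤ _ := by rw [h3]; linarith
  have h5 : ‖((‖x‖ ^ (a - 1) - ‖y‖ ^ (a - 1) : ℝ) : ℂ) * y‖ ≤ ‖x - y‖ ^ a := by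
    have h6 : ‖x‖ ^ (a - 1) ≤ ‖y‖ ^ (a - 1) :=
      Real.rpow_le_rpow_of_nonpos hy0 hxy (by linarith)
    rw [norm_mul, Complex.norm_real, Real.norm_of_nonpos (by linarith)]
    rcases eq_or_lt_of_le hxy with h | h
    · rw [h]; simp; positivity
    have h7 : ‖y‖ ^ (a - 1) * ‖y‖ = ‖y‖ ^ a := by
      rw [Real.rpow_sub_one hy0.ne']; field_simp
    have h8 : ‖x‖ ^ (a - 1) * ‖x‖ = ‖x‖ ^ a := by
      rw [Real.rpow_sub_one hx0.ne']; field_simp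
    have h9 : ‖y‖ ^ a ≤ ‖x‖ ^ a := Real.rpow_le_rpow hy0.le hxy ha.le
    have h10 : ‖x‖ ^ (a - 1) ≤ (‖x‖ - ‖y‖) ^ (a - 1) :=
      Real.rpow_le_rpow_of_nonpos (by linarith) (by linarith) (by linarith)
    have h11 : (‖x‖ - ‖y‖) ^ (a - 1) * (‖x‖ - ‖y‖) = (‖x‖ - ‖y‖) ^ a := by
      rw [Real.rpow_sub_one (by linarith)]
      have : ‖x‖ - ‖y‖ ≠ 0 := by linarith
      field_simp
    have h12 : (‖x‖ - ‖y‖) ^ a ≤ ‖x - y‖ ^ a :=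
      Real.rpow_le_rpow (by linarith) (norm_sub_norm_le x y) ha.le
    have h13 : ‖x‖ ^ (a - 1) * (‖x‖ - ‖y‖) ≤ (‖x‖ - ‖y‖) ^ (a - 1) * (‖x‖ - ‖y‖) :=
      mul_le_mul_of_nonneg_right h10 (by linarith)
    nlinarith
  rw [e]
  exact (norm_add_le _ _).trans (by linarith)

lemma mz_holder {a : ℝ} (ha : 0 < a) (ha1 : a < 1) (x y : ℂ) :
    ‖mz a x - mz a y‖ ≤ 3 * ‖x - y‖ ^ a := by
  rcases le_total ‖y‖ ‖x‖ with h | h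
  · exact mz_holder_aux ha ha1 h
  · rw [norm_sub_rev, norm_sub_rev x]; exact mz_holder_aux ha ha1 h

lemma rpow_sub_one_le {b r : ℝ} (hb : 1 ≤ b) (h0 : 0 ≤ r) (h2 : r ≤ 2) :
    |r ^ b - 1| ≤ b * 2 ^ b * |r - 1| := by
  have hB : (1 : ℝ) ≤ 2 ^ b := Real.one_le_rpow (by norm_num) (by linarith)
  rcases le_total r 1 with h | h
  · have h1 := one_add_mul_self_le_rpow_one_add (s := r - 1) (by linarith) hb
    rw [show 1 + (r - 1) = r by ring] at h1
    have h3 : r ^ b ≤ 1 := Real.rpow_le_one h0 h (by linarith)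
    rw [abs_of_nonpos (by linarith), abs_of_nonpos (by linarith)]
    have : b * (1 - r) ≤ b * 2 ^ b * (1 - r) := by
      apply mul_le_mul_of_nonneg_right _ (by linarith)
      nlinarith
    linarith
  · have hr : 0 < r := by linarith
    have h1 := one_add_mul_self_le_rpow_one_add (s := r⁻¹ - 1)
      (by have : 0 < r⁻¹ := by positivity
          linarith) hb
    rw [show 1 + (r⁻¹ - 1) = r⁻¹ by ring, Real.inv_rpow h0] at h1
    have h3 : 1 ≤ r ^ b := Real.one_le_rpow h (by linarith)
    have h4 : r ^ b ≤ 2 ^ b := Real.rpow_le_rpow h0 h2 (by linarith)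
    rw [abs_of_nonneg (by linarith), abs_of_nonneg (by linarith)]
    have h5 : r ^ b * (1 + b * (r⁻¹ - 1)) ≤ 1 := by
      have := mul_le_mul_of_nonneg_left h1 (by linarith : (0 : ℝ) ≤ r ^ b)
      rwa [mul_inv_cancel₀ (by linarith)] at this
    have h6 : 1 - r⁻¹ ≤ r - 1 := by
      rw [show 1 - r⁻¹ = (r - 1) / r by field_simp]
      exact div_le_self (by linarith) h
    have h7 : 0 ≤ 1 - r⁻¹ := by
      have := inv_le_one_of_one_le₀ h
      linarith
    calc r ^ b - 1 ≤ b * (r ^ b * (1 - r⁻¹)) := by nlinarith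
      _ ≤ b * (2 ^ b * (r - 1)) := by gcongr
      _ = _ := by ring

lemma mz_near_one {a b : ℝ} (ha : 0 < a) (hb : 1 ≤ b) (hab : a * b = 1) :
    ∃ C : ℝ, 0 < C ∧ ∀ w : ℂ, min ‖w - 1‖ 1 ≤ C * ‖mz a w - 1‖ := by
  have hB : (1 : ℝ) ≤ 2 ^ b := Real.one_le_rpow (by norm_num) (by linarith)
  refine ⟨2 + b * 2 ^ b, by positivity, fun w => ?_⟩
  set z := mz a w with hz
  have hw : w = mz b z := (mz_mz ha hab w).symm
  have hbb : 0 < b * 2 ^ b := by positivity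
  rcases le_total 1 ‖z - 1‖ with h | h
  · refine (min_le_right _ _).trans ?_
    nlinarith
  have hz2 : ‖z‖ ≤ 2 := by
    have := norm_sub_norm_le z 1
    rw [norm_one] at this
    linarith
  have hz1 : |‖z‖ - 1| ≤ ‖z - 1‖ := by
    simpa using abs_norm_sub_norm_le z 1
  refine (min_le_left _ _).trans ?_
  have e : w - 1 = (z - 1) + (mz b z - z) := by rw [hw]; ring
  have h1 : ‖mz b z - z‖ = |‖z‖ ^ b - ‖z‖| := by
    rcases eq_or_ne z 0 with h0 | h0
    · rw [h0]; simp [mz_zero, Real.zero_rpow (show b ≠ 0 by linarith)]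
    have hp : 0 < ‖z‖ := norm_pos_iff.2 h0
    rw [show mz b z - z = ((‖z‖ ^ (b - 1) - 1 : ℝ) : ℂ) * z by unfold mz; push_cast; ring,
      norm_mul, Complex.norm_real, Real.norm_eq_abs, Real.rpow_sub_one hp.ne']
    nth_rw 3 [← abs_of_pos hp]
    rw [← abs_mul]
    congr 1
    field_simp
  have h2 := rpow_sub_one_le hb (norm_nonneg z) hz2
  have h3 : |‖z‖ ^ b - ‖z‖| ≤ |‖z‖ ^ b - 1| + |‖z‖ - 1| := by
    rw [abs_sub_comm ‖z‖ 1]; exact abs_sub_le _ _ _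
  have h4 : b * 2 ^ b * |‖z‖ - 1| ≤ b * 2 ^ b * ‖z - 1‖ := by gcongr
  rw [e]
  refine (norm_add_le _ _).trans ?_
  rw [h1]
  linarith

lemma min_rpow_le {a q s A B : ℝ} (hq : 0 < q) (hs : q ≤ s) (hA : 0 ≤ A) (hB : 0 ≤ B)
    (ha : 0 < a) (has : a * s = q) {c : ℝ} (hc0 : 0 ≤ c) (hc : c ≤ A + B ^ a) :
    min c 1 ^ s ≤ 2 ^ s * (A ^ q + min B 1 ^ q) := by
  have hs0 : 0 < s := hq.trans_le hs
  have hmB : min B 1 ^ q = (min (B ^ a) 1) ^ s := by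
    rw [← has, Real.rpow_mul (by positivity)]
    congr 1
    rcases le_total B 1 with h | h
    · rw [min_eq_left h, min_eq_left (Real.rpow_le_one hB h ha.le)]
    · rw [min_eq_right h, min_eq_right (Real.one_le_rpow h ha.le), Real.one_rpow]
  have hmA : min A 1 ^ s ≤ A ^ q := by
    rcases le_total A 1 with h | h
    · rw [min_eq_left h]
      rcases eq_or_lt_of_le hA with h0 | h0
      · rw [← h0, Real.zero_rpow hs0.ne', Real.zero_rpow hq.ne']
      exact Real.rpow_le_rpow_of_exponent_ge h0 h hs
    · rw [min_eq_right h, Real.one_rpow]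
      exact Real.one_le_rpow h hq.le
  have hBa : 0 ≤ B ^ a := by positivity
  rw [hmB]
  rcases le_total A (B ^ a) with h | h
  · have h1 : min c 1 ≤ 2 * min (B ^ a) 1 := by
      rcases le_total (B ^ a) 1 with h' | h'
      · rw [min_eq_left h']; exact (min_le_left _ _).trans (by linarith)
      · rw [min_eq_right h']; exact (min_le_right _ _).trans (by linarith)
    calc min c 1 ^ s ≤ (2 * min (B ^ a) 1) ^ s := by gcongr
      _ = 2 ^ s * min (B ^ a) 1 ^ s := by rw [Real.mul_rpow (by norm_num) (by positivity)]
      _ ≤ _ := by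
        have : 0 ≤ A ^ q := by positivity
        gcongr; linarith
  · have h1 : min c 1 ≤ 2 * min A 1 := by
      rcases le_total A 1 with h' | h'
      · rw [min_eq_left h']; exact (min_le_left _ _).trans (by linarith)
      · rw [min_eq_right h']; exact (min_le_right _ _).trans (by linarith)
    calc min c 1 ^ s ≤ (2 * min A 1) ^ s := by gcongr
      _ = 2 ^ s * min A 1 ^ s := by rw [Real.mul_rpow (by norm_num) (by positivity)]
      _ ≤ _ := by
        have : 0 ≤ min (B ^ a) 1 ^ s := by positivity
        gcongr; linarith

open scoped ENNReal in
open ProbabilityTheory Set Filter Topology in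
lemma exists_median_kernel {Ω : Type*} [MeasurableSpace Ω] (κ : Kernel Ω ℝ) [IsMarkovKernel κ] :
    ∃ K : Ω → ℝ, Measurable K ∧ (∀ x, (1 / 2 : ℝ≥0∞) ≤ κ x (Iic (K x))) ∧
      ∀ x, (1 / 2 : ℝ≥0∞) ≤ κ x (Ici (K x)) := by
  have key : ∀ x, ∃ k : ℝ, ∀ r, k ≤ r ↔ (1 / 2 : ℝ) ≤ cdf (κ x) r := by
    intro x
    set F := cdf (κ x)
    set S := {r | (1 / 2 : ℝ) ≤ F r}
    have hne : S.Nonempty := by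
      have h := (tendsto_cdf_atTop (κ x)).eventually (lt_mem_nhds (show (1 / 2 : ℝ) < 1 by norm_num))
      obtain ⟨r, hr⟩ := h.exists
      exact ⟨r, hr.le⟩
    have hbd : BddBelow S := by
      have h := (tendsto_cdf_atBot (κ x)).eventually (gt_mem_nhds (show (0 : ℝ) < 1 / 2 by norm_num))
      obtain ⟨r, hr⟩ := h.exists
      refine ⟨r, fun t ht => ?_⟩
      by_contra hlt
      push Not at hlt
      have h1 := monotone_cdf (κ x) hlt.le
      have h2 : (1 / 2 : ℝ) ≤ F t := ht
      linarith
    have hmem : (1 / 2 : ℝ) ≤ F (sInf S) := by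
      have hc : Tendsto F (𝓝[>] (sInf S)) (𝓝 (F (sInf S))) :=
        (F.right_continuous (sInf S)).mono_left (nhdsWithin_mono _ Ioi_subset_Ici_self)
      refine ge_of_tendsto hc ?_
      filter_upwards [self_mem_nhdsWithin] with r hr
      obtain ⟨t, ht, htr⟩ := exists_lt_of_csInf_lt hne hr
      exact le_trans ht (F.mono htr.le)
    refine ⟨sInf S, fun r => ⟨fun h => hmem.trans (F.mono h), fun h => csInf_le hbd h⟩⟩
  choose K hK using key
  have hiff : ∀ x r, K x ≤ r ↔ (1 / 2 : ℝ≥0∞) ≤ κ x (Iic r) := by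
    intro x r
    rw [hK, ← ofReal_cdf, show (1 / 2 : ℝ≥0∞) = ENNReal.ofReal (1 / 2) by
      rw [ENNReal.ofReal_div_of_pos (by norm_num)]; simp]
    rw [ENNReal.ofReal_le_ofReal_iff (cdf_nonneg _ _)]
  refine ⟨K, ?_, fun x => (hiff x _).1 le_rfl, fun x => ?_⟩
  · refine measurable_of_Iic fun r => ?_
    have : K ⁻¹' Iic r = {x | (1 / 2 : ℝ≥0∞) ≤ κ x (Iic r)} := by
      ext x; exact hiff x r
    rw [this]
    exact measurableSet_le measurable_const (κ.measurable_coe measurableSet_Iic)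
  · have h1 : κ x (Iio (K x)) ≤ 1 / 2 := by
      obtain ⟨u, hu, hlt, htend⟩ := exists_seq_strictMono_tendsto (K x)
      have hU : Iio (K x) = ⋃ n, Iic (u n) := by
        ext t
        simp only [mem_Iio, mem_iUnion, mem_Iic]
        refine ⟨fun h => ?_, fun ⟨n, h⟩ => h.trans_lt (hlt n)⟩
        obtain ⟨n, hn⟩ := (htend.eventually (lt_mem_nhds h)).exists
        exact ⟨n, hn.le⟩
      rw [hU, Monotone.measure_iUnion (fun m n h => Iic_subset_Iic.2 (hu.monotone h))]
      refine iSup_le fun n => ?_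
      by_contra hcon
      push Not at hcon
      exact absurd ((hiff x (u n)).2 hcon.le) (not_le.2 (hlt n))
    have h2 : κ x (Ici (K x)) = 1 - κ x (Iio (K x)) := by
      rw [← compl_Iio, prob_compl_eq_one_sub measurableSet_Iio]
    rw [h2]
    calc (1 / 2 : ℝ≥0∞) = 1 - 1 / 2 := by simp
      _ ≤ _ := by gcongr

open scoped ENNReal in
open ProbabilityTheory Set in
lemma exists_median_aux {X Ω : Type*} [MeasurableSpace X] [MeasurableSpace Ω]
    {j : X → Ω} (hj : Measurable j)
    (l : Measure X) [IsFiniteMeasure l] {v : X → ℝ} (hv : Measurable v) :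
    ∃ K : Ω → ℝ, Measurable K ∧ ∀ W : Ω → ℝ≥0∞, Measurable W →
      (∫⁻ x, W (j x) ∂l ≤ 2 * ∫⁻ x, W (j x) * ({x | v x ≤ K (j x)}.indicator 1 x) ∂l) ∧
      (∫⁻ x, W (j x) ∂l ≤ 2 * ∫⁻ x, W (j x) * ({x | K (j x) ≤ v x}.indicator 1 x) ∂l) := by
  have hmap : Measurable (fun x => (j x, v x)) := hj.prodMk hv
  let ρ : Measure (Ω × ℝ) := l.map (fun x => (j x, v x))
  obtain ⟨K, hKm, hK1, hK2⟩ := exists_median_kernel (ρ.condKernel)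
  have half : ∀ (a : ℝ≥0∞), a = 2 * (a * (1 / 2)) := by
    intro a
    rw [mul_comm a, ← mul_assoc]; simp [ENNReal.mul_inv_cancel]
  have general : ∀ (W : Ω → ℝ≥0∞), Measurable W → ∀ (E : Set (Ω × ℝ)),
      MeasurableSet E →
      (∀ x, (1 / 2 : ℝ≥0∞) ≤ ρ.condKernel x {t | (x, t) ∈ E}) →
      ∫⁻ x, W (j x) ∂l ≤ 2 * ∫⁻ x, W (j x) * (E.indicator 1 (j x, v x)) ∂l := by
    intro W hW E hE hκ
    have hWE : Measurable fun z : Ω × ℝ => W z.1 * E.indicator 1 z :=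
      (hW.comp measurable_fst).mul (measurable_one.indicator hE)
    have hW1 : Measurable fun z : Ω × ℝ => W z.1 := hW.comp measurable_fst
    have e1 : ∫⁻ x, W (j x) * (E.indicator 1 (j x, v x)) ∂l
        = ∫⁻ z, W z.1 * E.indicator 1 z ∂ρ := by
      rw [lintegral_map hWE hmap]
    have e2 : ∫⁻ x, W (j x) ∂l = ∫⁻ z, W z.1 ∂ρ := by
      rw [lintegral_map hW1 hmap]
    rw [e1, e2, ← ρ.disintegrate ρ.condKernel,
      Measure.lintegral_compProd hW1,
      Measure.lintegral_compProd hWE, ← lintegral_const_mul']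
    swap
    · simp
    refine lintegral_mono fun x => ?_
    have hs : MeasurableSet {t : ℝ | (x, t) ∈ E} := measurable_prodMk_left hE
    have e3 : ∫⁻ t, W x * E.indicator 1 (x, t) ∂(ρ.condKernel x)
        = W x * ρ.condKernel x {t | (x, t) ∈ E} := by
      rw [lintegral_const_mul, ← lintegral_indicator_one hs]
      · rfl
      · exact (measurable_one.indicator hE).comp measurable_prodMk_left
    simp only [e3, lintegral_const, measure_univ, mul_one]
    calc W x = 2 * (W x * (1 / 2)) := half _
      _ ≤ _ := by gcongr; exact hκ x
  refine ⟨K, hKm, fun W hW => ⟨?_, ?_⟩⟩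
  · exact general W hW {z | z.2 ≤ K z.1}
      (measurableSet_le measurable_snd (hKm.comp measurable_fst)) hK1
  · exact general W hW {z | K z.1 ≤ z.2}
      (measurableSet_le (hKm.comp measurable_fst) measurable_snd) hK2

open scoped ENNReal in
lemma exists_median {X : Type*} {m m0 : MeasurableSpace X} (hm : m ≤ m0)
    (l : @Measure X m0) [IsFiniteMeasure l] {v : X → ℝ} (hv : Measurable[m0] v) :
    ∃ K : X → ℝ, Measurable[m] K ∧ ∀ W : X → ℝ≥0∞, Measurable[m] W →
      (∫⁻ x, W x ∂l ≤ 2 * ∫⁻ x, W x * ({x | v x ≤ K x}.indicator 1 x) ∂l) ∧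
      (∫⁻ x, W x ∂l ≤ 2 * ∫⁻ x, W x * ({x | K x ≤ v x}.indicator 1 x) ∂l) :=
  @exists_median_aux X X m0 m id (measurable_id'' hm) l _ v hv

/-- Finiteness of the integral of a nonnegative real function. -/
def FinI {X : Type*} [MeasurableSpace X] (μ : Measure X) (w : X → ℝ) : Prop :=
  ∫⁻ x, ENNReal.ofReal (w x) ∂μ < ⊤

section FinISection

variable {X : Type*} [MeasurableSpace X] {μ : Measure X}

lemma FinI.mono {w w' : X → ℝ} (h : FinI μ w') (C : ℝ) (hC : 0 ≤ C)
    (hle : ∀ᵐ x ∂μ, w x ≤ C * w' x) : FinI μ w := by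
  unfold FinI at *
  calc ∫⁻ x, ENNReal.ofReal (w x) ∂μ ≤ ∫⁻ x, ENNReal.ofReal C * ENNReal.ofReal (w' x) ∂μ := by
        refine lintegral_mono_ae ?_
        filter_upwards [hle] with x hx
        rw [← ENNReal.ofReal_mul hC]
        exact ENNReal.ofReal_le_ofReal hx
    _ = ENNReal.ofReal C * ∫⁻ x, ENNReal.ofReal (w' x) ∂μ :=
        lintegral_const_mul' _ _ ENNReal.ofReal_ne_top
    _ < ⊤ := ENNReal.mul_lt_top ENNReal.ofReal_lt_top h

lemma FinI.add {w w' : X → ℝ} (h : FinI μ w) (h' : FinI μ w') (hw : Measurable w) :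
    FinI μ (fun x => w x + w' x) := by
  unfold FinI at *
  calc ∫⁻ x, ENNReal.ofReal (w x + w' x) ∂μ
      ≤ ∫⁻ x, ENNReal.ofReal (w x) + ENNReal.ofReal (w' x) ∂μ :=
        lintegral_mono fun x => ENNReal.ofReal_add_le
    _ = _ := lintegral_add_left hw.ennreal_ofReal _
    _ < ⊤ := ENNReal.add_lt_top.2 ⟨h, h'⟩

lemma memLp_iff_finI {p : ℝ} (hp : 0 < p) {f : X → ℂ} (hf : AEStronglyMeasurable f μ) :
    MemLp f (ENNReal.ofReal p) μ ↔ FinI μ (fun x => ‖f x‖ ^ p) := by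
  have h0 : ENNReal.ofReal p ≠ 0 := by simpa using hp
  rw [MemLp, eLpNorm_lt_top_iff_lintegral_rpow_enorm_lt_top h0 ENNReal.ofReal_ne_top,
    ENNReal.toReal_ofReal hp.le]
  simp only [hf, true_and, FinI]
  have : ∀ x, ‖f x‖ₑ ^ p = ENNReal.ofReal (‖f x‖ ^ p) := by
    intro x
    rw [← ofReal_norm, ENNReal.ofReal_rpow_of_nonneg (norm_nonneg _) hp.le]
  simp only [this]

/-- The σ-algebra of almost everywhere invariant measurable sets. -/
@[reducible] def invSigma {ι : Type*} (μ : Measure X) (τ : ι → X → X) : MeasurableSpace X where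
  MeasurableSet' A := MeasurableSet A ∧ ∀ g, ∀ᵐ x ∂μ, (τ g x ∈ A ↔ x ∈ A)
  measurableSet_empty := ⟨MeasurableSet.empty, fun g => by simp⟩
  measurableSet_compl := fun A hA => ⟨hA.1.compl, fun g => by
    filter_upwards [hA.2 g] with x hx
    simp [hx]⟩
  measurableSet_iUnion := fun A hA => ⟨MeasurableSet.iUnion fun n => (hA n).1, fun g => by
    have : ∀ᵐ x ∂μ, ∀ n, (τ g x ∈ A n ↔ x ∈ A n) := ae_all_iff.2 fun n => (hA n).2 g
    filter_upwards [this] with x hx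
    simp [hx]⟩

lemma invSigma_le {ι : Type*} (μ : Measure X) (τ : ι → X → X) :
    invSigma μ τ ≤ ‹MeasurableSpace X› := fun _ hA => hA.1

lemma measurable_invSigma {ι : Type*} {τ : ι → X → X} {K : X → ℝ} (hK : Measurable K)
    (hinv : ∀ g, ∀ᵐ x ∂μ, K (τ g x) = K x) : Measurable[invSigma μ τ] K := by
  intro B hB
  refine ⟨hK hB, fun g => ?_⟩
  filter_upwards [hinv g] with x hx
  simp [hx]

lemma inv_of_measurable_invSigma {ι : Type*} {τ : ι → X → X} {K : X → ℝ}
    (hK : Measurable[invSigma μ τ] K) (g : ι) : ∀ᵐ x ∂μ, K (τ g x) = K x := by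
  have h : ∀ᵐ x ∂μ, ∀ r : ℚ, (K (τ g x) < r ↔ K x < r) :=
    ae_all_iff.2 fun r => (hK (measurableSet_Iio (a := (r : ℝ)))).2 g
  filter_upwards [h] with x hx
  by_contra hne
  rcases lt_or_gt_of_ne hne with h1 | h1
  · obtain ⟨r, hr1, hr2⟩ := exists_rat_btwn h1
    exact absurd ((hx r).1 hr1) (not_lt.2 hr2.le)
  · obtain ⟨r, hr1, hr2⟩ := exists_rat_btwn h1
    exact absurd ((hx r).2 hr1) (not_lt.2 hr2.le)

lemma rpow_add_le_two {q A B : ℝ} (hq : 0 < q) (hA : 0 ≤ A) (hB : 0 ≤ B) :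
    (A + B) ^ q ≤ 2 ^ q * (A ^ q + B ^ q) := by
  have hAq : 0 ≤ A ^ q := by positivity
  have hBq : 0 ≤ B ^ q := by positivity
  rcases le_total A B with h | h
  · calc (A + B) ^ q ≤ (2 * B) ^ q := by gcongr; linarith
      _ = 2 ^ q * B ^ q := Real.mul_rpow (by norm_num) hB
      _ ≤ _ := by gcongr; linarith
  · calc (A + B) ^ q ≤ (2 * A) ^ q := by gcongr; linarith
      _ = 2 ^ q * A ^ q := Real.mul_rpow (by norm_num) hA
      _ ≤ _ := by gcongr; linarith

lemma sp_nonneg {a v : ℝ} (hv : 0 ≤ v) : 0 ≤ sp a v := by unfold sp; positivity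

lemma sp_nonpos {a v : ℝ} (hv : v ≤ 0) : sp a v ≤ 0 :=
  mul_nonpos_of_nonneg_of_nonpos (by positivity) hv

lemma lemB {ι : Type*} {p q a : ℝ} (hp : 0 < p) (hpq : p < q) (ha : a = p / q)
    {τ : ι → X → X} {w : X → ℝ} (hw : Measurable w) (hw0 : ∀ x, 0 ≤ w x)
    (HB : ∀ v : X → ℝ, Measurable v →
      (∀ g, FinI μ (fun x => w x * |v (τ g x) - v x| ^ p)) →
      ∃ c : X → ℝ, Measurable c ∧ (∀ g, ∀ᵐ x ∂μ, c (τ g x) = c x) ∧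
        FinI μ (fun x => w x * |sp a (v x) - c x| ^ q))
    {v : X → ℝ} (hv : Measurable v)
    (hdv : ∀ g, FinI μ (fun x => w x * |v (τ g x) - v x| ^ p))
    (hv1 : FinI μ (fun x => w x * min |v x| 1 ^ q)) :
    ∃ K : X → ℝ, Measurable K ∧ (∀ g, ∀ᵐ x ∂μ, K (τ g x) = K x) ∧
      FinI μ (fun x => w x * |v x - K x| ^ p) := by
  have hq : 0 < q := hp.trans hpq
  have ha0 : 0 < a := by rw [ha]; positivity
  have ha1 : a < 1 := by rw [ha, div_lt_one hq]; exact hpq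
  have haq : a * q = p := by rw [ha]; field_simp
  have habs : Measurable fun t : ℝ => |t| := measurable_norm
  have hspm := sp_measurable a
  obtain ⟨c, hcm, hcinv, hcF⟩ := HB v hv hdv
  set s : ℝ := q / a with hs
  have has : a * s = q := by rw [hs]; field_simp
  have hqs : q ≤ s := by rw [hs, le_div_iff₀ ha0]; nlinarith
  have hs0 : 0 < s := by positivity
  let ψ : X → ℝ := fun x => min |c x| 1 ^ s
  have hψm : Measurable ψ := by fun_prop
  have hψ0 : ∀ x, 0 ≤ ψ x := fun x => by positivity
  have hψpos : ∀ x, c x ≠ 0 → 0 < ψ x := fun x hx => by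
    have : 0 < |c x| := abs_pos.2 hx
    have : 0 < min |c x| 1 := lt_min this one_pos
    positivity
  have hψF : FinI μ (fun x => w x * ψ x) := by
    refine (hcF.add hv1 (by fun_prop)).mono (2 ^ s) (by positivity) (ae_of_all _ fun x => ?_)
    have h := min_rpow_le hq hqs (abs_nonneg (sp a (v x) - c x)) (abs_nonneg (v x)) ha0 has
      (abs_nonneg (c x)) (by
        rw [← abs_sp ha0]
        have := abs_sub_le (c x) (sp a (v x)) 0
        rw [sub_zero, sub_zero, abs_sub_comm (c x)] at this
        exact this)
    calc w x * ψ x ≤ w x * (2 ^ s * (|sp a (v x) - c x| ^ q + min |v x| 1 ^ q)) :=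
          mul_le_mul_of_nonneg_left h (hw0 x)
      _ = _ := by ring
  let l : Measure X := μ.withDensity fun x => ENNReal.ofReal (w x * ψ x)
  have hlf : IsFiniteMeasure l := ⟨by
    rw [withDensity_apply _ MeasurableSet.univ, Measure.restrict_univ]
    exact hψF⟩
  obtain ⟨K0, hK0m, hK0⟩ := exists_median (invSigma_le μ τ) l hv
  have hK0m' : Measurable K0 := hK0m.mono (invSigma_le μ τ) le_rfl
  let K : X → ℝ := fun x => if c x = 0 then 0 else K0 x
  have hc0 : MeasurableSet {x | c x = 0} := hcm (measurableSet_singleton 0)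
  have hKm : Measurable K := Measurable.ite hc0 measurable_const hK0m'
  have hKinv : ∀ g, ∀ᵐ x ∂μ, K (τ g x) = K x := by
    intro g
    filter_upwards [hcinv g, inv_of_measurable_invSigma hK0m g] with x h1 h2
    simp only [K, h1, h2]
  obtain ⟨c3, hc3m, hc3inv, hc3F⟩ := HB (fun x => v x - K x) (hv.sub hKm) (by
    intro g
    refine (hdv g).mono 1 zero_le_one ?_
    filter_upwards [hKinv g] with x hx
    rw [hx, one_mul, sub_sub_sub_cancel_right])
  have hcI := measurable_invSigma hcm hcinv
  have hc3I := measurable_invSigma hc3m hc3inv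
  let W : X → ENNReal := fun x => ENNReal.ofReal (|c3 x| ^ q / ψ x)
  have hWI : Measurable[invSigma μ τ] W := by
    have h1 : Measurable fun z : ℝ × ℝ => ENNReal.ofReal (|z.1| ^ q / min |z.2| 1 ^ s) := by
      fun_prop
    exact h1.comp (hc3I.prodMk hcI)
  have sub : ∀ P Q : Set X, MeasurableSet[invSigma μ τ] P → MeasurableSet Q →
      (∀ V : X → ENNReal, Measurable[invSigma μ τ] V →
        ∫⁻ x, V x ∂l ≤ 2 * ∫⁻ x, V x * (Q.indicator 1 x) ∂l) →
      (∀ x, c x ≠ 0 → x ∈ P → x ∈ Q → |c3 x| ≤ |sp a (v x - K x) - c3 x|) →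
      FinI μ (({x | c x ≠ 0} ∩ P).indicator fun x => w x * |c3 x| ^ q) := by
    intro P Q hP hQ hV hPQ
    set R : Set X := {x | c x ≠ 0} ∩ P with hR
    have hRI : MeasurableSet[invSigma μ τ] R :=
      MeasurableSet.inter (hcI (measurableSet_singleton 0).compl) hP
    have hRm : MeasurableSet R := invSigma_le μ τ _ hRI
    have hRWI : Measurable[invSigma μ τ] (R.indicator W) := Measurable.indicator hWI hRI
    have hRW : Measurable (R.indicator W) := hRWI.mono (invSigma_le μ τ) le_rfl
    have hdm : Measurable fun x => ENNReal.ofReal (w x * ψ x) := by fun_prop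
    have hRWQ : Measurable fun x => R.indicator W x * Q.indicator 1 x :=
      hRW.mul (measurable_one.indicator hQ)
    have h1 := hV _ hRWI
    rw [lintegral_withDensity_eq_lintegral_mul _ hdm hRW,
      lintegral_withDensity_eq_lintegral_mul _ hdm hRWQ] at h1
    have e : ∀ x, ENNReal.ofReal (w x * ψ x) * R.indicator W x
        = ENNReal.ofReal (R.indicator (fun x => w x * |c3 x| ^ q) x) := by
      intro x
      by_cases hx : x ∈ R
      · rw [Set.indicator_of_mem hx, Set.indicator_of_mem hx,
          ← ENNReal.ofReal_mul (mul_nonneg (hw0 x) (hψ0 x))]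
        congr 1
        have := hψpos x hx.1
        field_simp
      · rw [Set.indicator_of_notMem hx, Set.indicator_of_notMem hx]; simp
    unfold FinI
    calc ∫⁻ x, ENNReal.ofReal (R.indicator (fun x => w x * |c3 x| ^ q) x) ∂μ
        = ∫⁻ x, ((fun x => ENNReal.ofReal (w x * ψ x)) * R.indicator W) x ∂μ := by
          refine lintegral_congr fun x => ?_
          rw [← e]; rfl
      _ ≤ _ := h1
      _ ≤ 2 * ∫⁻ x, ENNReal.ofReal (w x * |sp a (v x - K x) - c3 x| ^ q) ∂μ := by
          gcongr with x
          simp only [Pi.mul_apply]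
          rw [← mul_assoc, e]
          by_cases hx : x ∈ R
          · by_cases hxQ : x ∈ Q
            · rw [Set.indicator_of_mem hx, Set.indicator_of_mem hxQ, Pi.one_apply, mul_one]
              have := hPQ x hx.1 hx.2 hxQ
              have := hw0 x
              gcongr
            · rw [Set.indicator_of_notMem hxQ]; simp
          · rw [Set.indicator_of_notMem hx]; simp
      _ < ⊤ := ENNReal.mul_lt_top (by simp) hc3F
  have s1 := sub {x | 0 < c3 x} {x | v x ≤ K0 x} (hc3I measurableSet_Ioi)
    (measurableSet_le hv hK0m') (fun V hV => (hK0 V hV).1) (by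
      intro x hx h1 h2
      have h1 : 0 < c3 x := h1
      have h2 : v x ≤ K0 x := h2
      have h3 : K x = K0 x := if_neg hx
      have h4 : sp a (v x - K x) ≤ 0 := sp_nonpos (by linarith)
      rw [abs_of_pos h1, abs_of_neg (by linarith)]
      linarith)
  have s2 := sub {x | c3 x < 0} {x | K0 x ≤ v x} (hc3I measurableSet_Iio)
    (measurableSet_le hK0m' hv) (fun V hV => (hK0 V hV).2) (by
      intro x hx h1 h2
      have h1 : c3 x < 0 := h1
      have h2 : K0 x ≤ v x := h2
      have h3 : K x = K0 x := if_neg hx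
      have h4 : 0 ≤ sp a (v x - K x) := sp_nonneg (by linarith)
      rw [abs_of_neg h1, abs_of_pos (by linarith)]
      linarith)
  refine ⟨K, hKm, hKinv, ?_⟩
  have hvK : Measurable fun x => v x - K x := hv.sub hKm
  have m1 : Measurable fun x => w x * |sp a (v x) - c x| ^ q := by fun_prop
  have m2 : Measurable fun x => w x * |sp a (v x - K x) - c3 x| ^ q := by fun_prop
  have m3 : Measurable (({x | c x ≠ 0} ∩ {x | 0 < c3 x}).indicator
      fun x => w x * |c3 x| ^ q) :=
    Measurable.indicator (by fun_prop) (hc0.compl.inter (hc3m measurableSet_Ioi))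
  refine (hcF.add (hc3F.add (s1.add s2 m3) m2) m1).mono (2 ^ q) (by positivity)
    (ae_of_all _ fun x => ?_)
  have hw' := hw0 x
  have hpow : ∀ t : ℝ, |t| ^ p = |sp a t| ^ q := by
    intro t
    rw [abs_sp ha0, ← Real.rpow_mul (abs_nonneg _), haq]
  have h2q : (1 : ℝ) ≤ 2 ^ q := Real.one_le_rpow (by norm_num) hq.le
  have t1 : 0 ≤ w x * |sp a (v x) - c x| ^ q := by positivity
  have t2 : 0 ≤ w x * |sp a (v x - K x) - c3 x| ^ q := by positivity
  have tt : ∀ R : Set X, 0 ≤ R.indicator (fun x => w x * |c3 x| ^ q) x := fun R =>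
    Set.indicator_nonneg (fun y _ => mul_nonneg (hw0 y) (by positivity)) x
  have t3 := tt ({x | c x ≠ 0} ∩ {x | 0 < c3 x})
  have t4 := tt ({x | c x ≠ 0} ∩ {x | c3 x < 0})
  by_cases hx : c x = 0
  · have hK : K x = 0 := if_pos hx
    have h1 : w x * |v x - K x| ^ p = w x * |sp a (v x) - c x| ^ q := by
      rw [hK, hx, sub_zero, sub_zero, hpow]
    rw [h1]
    nlinarith
  · have h1 : w x * |c3 x| ^ q
        ≤ ({x | c x ≠ 0} ∩ {x | 0 < c3 x}).indicator (fun x => w x * |c3 x| ^ q) x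
        + ({x | c x ≠ 0} ∩ {x | c3 x < 0}).indicator (fun x => w x * |c3 x| ^ q) x := by
      rcases lt_trichotomy (c3 x) 0 with h | h | h
      · have : x ∈ ({x | c x ≠ 0} ∩ {x | c3 x < 0}) := ⟨hx, h⟩
        rw [Set.indicator_of_mem this (fun x => w x * |c3 x| ^ q)]
        linarith
      · rw [h, abs_zero, Real.zero_rpow hq.ne', mul_zero]; linarith
      · have : x ∈ ({x | c x ≠ 0} ∩ {x | 0 < c3 x}) := ⟨hx, h⟩
        rw [Set.indicator_of_mem this (fun x => w x * |c3 x| ^ q)]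
        linarith
    have h2 : |sp a (v x - K x)| ^ q
        ≤ 2 ^ q * (|sp a (v x - K x) - c3 x| ^ q + |c3 x| ^ q) := by
      refine le_trans ?_ (rpow_add_le_two hq (abs_nonneg _) (abs_nonneg _))
      have := abs_sub_le (sp a (v x - K x)) (c3 x) 0
      rw [sub_zero, sub_zero] at this
      gcongr
    rw [hpow]
    calc w x * |sp a (v x - K x)| ^ q
        ≤ w x * (2 ^ q * (|sp a (v x - K x) - c3 x| ^ q + |c3 x| ^ q)) := by gcongr
      _ = 2 ^ q * (w x * |sp a (v x - K x) - c3 x| ^ q + w x * |c3 x| ^ q) := by ring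
      _ ≤ _ := mul_le_mul_of_nonneg_left (by linarith) (by positivity)

end FinISection

/-- Abstract weighted composition operators. -/
noncomputable def TT {X ι : Type*} (d : ι → X → ℝ) (ω : ι → X → ℂ) (τ : ι → X → X)
    (r : ℝ) (g : ι) (f : X → ℂ) : X → ℂ :=
  fun x => ((d g x ^ r⁻¹ : ℝ) : ℂ) * ω g x * f (τ g x)

section Abstract

variable {X ι : Type*} [MeasurableSpace X] {μ : Measure X}
  {d : ι → X → ℝ} {ω : ι → X → ℂ} {τ : ι → X → X}

lemma TT_measurable (hd : ∀ g, Measurable (d g)) (hω : ∀ g, Measurable (ω g))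
    (hτ : ∀ g, Measurable (τ g)) (r : ℝ) (g : ι) {f : X → ℂ} (hf : Measurable f) :
    Measurable (TT d ω τ r g f) := by
  have h1 := hd g
  have h2 := hω g
  have h3 := hτ g
  unfold TT
  fun_prop

lemma mz_TT {p a q : ℝ} (haq : p⁻¹ * a = q⁻¹) {g : ι} {f : X → ℂ} {x : X}
    (hd : 0 < d g x) (hω : ‖ω g x‖ = 1) :
    mz a (TT d ω τ p g f x) = TT d ω τ q g (fun y => mz a (f y)) x := by
  unfold TT
  rw [mz_mul, mz_mul, mz_circ a hω, mz_pos a (by positivity), ← Real.rpow_mul hd.le, haq]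

lemma lemA {p q a : ℝ} (hp : 0 < p) (hpq : p < q) (ha : a = p / q)
    (hd : ∀ g, Measurable (d g)) (hω : ∀ g, Measurable (ω g))
    (hτ : ∀ g, Measure.QuasiMeasurePreserving (τ g) μ μ)
    (hd0 : ∀ g, ∀ᵐ x ∂μ, 0 < d g x) (hω1 : ∀ g, ∀ᵐ x ∂μ, ‖ω g x‖ = 1)
    (Hq : ∀ f : X → ℂ, Measurable f →
      (∀ g, MemLp (fun x => TT d ω τ q g f x - f x) (ENNReal.ofReal q) μ) →
      ∃ h : X → ℂ, MemLp h (ENNReal.ofReal q) μ ∧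
        ∀ g, (fun x => TT d ω τ q g f x - f x) =ᵐ[μ] fun x => TT d ω τ q g h x - h x)
    {f : X → ℂ} (hf : Measurable f)
    (hF : ∀ g, FinI μ (fun x => ‖TT d ω τ p g f x - f x‖ ^ p)) :
    ∃ F : X → ℂ, Measurable F ∧ (∀ g, ∀ᵐ x ∂μ, TT d ω τ q g F x = F x) ∧
      FinI μ (fun x => ‖mz a (f x) - F x‖ ^ q) := by
  have hq : 0 < q := hp.trans hpq
  have ha0 : 0 < a := by rw [ha]; positivity
  have ha1 : a < 1 := by rw [ha, div_lt_one hq]; exact hpq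
  have haq : a * q = p := by rw [ha]; field_simp
  have hpa : p⁻¹ * a = q⁻¹ := by rw [ha]; field_simp
  have hMf : Measurable fun x => mz a (f x) := (mz_measurable a).comp hf
  obtain ⟨h, hh, hhe⟩ := Hq (fun x => mz a (f x)) hMf (by
    intro g
    have hTm : Measurable fun x => TT d ω τ q g (fun x => mz a (f x)) x - mz a (f x) :=
      (TT_measurable hd hω (fun g => (hτ g).measurable) q g hMf).sub hMf
    rw [memLp_iff_finI hq hTm.aestronglyMeasurable]
    refine (hF g).mono (3 ^ q) (by positivity) ?_
    filter_upwards [hd0 g, hω1 g] with x h1 h2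
    rw [← mz_TT hpa h1 h2]
    calc ‖mz a (TT d ω τ p g f x) - mz a (f x)‖ ^ q
        ≤ (3 * ‖TT d ω τ p g f x - f x‖ ^ a) ^ q := by
          gcongr; exact mz_holder ha0 ha1 _ _
      _ = _ := by
          rw [Real.mul_rpow (by norm_num) (by positivity), ← Real.rpow_mul (norm_nonneg _), haq])
  have hhm := hh.1
  set h' := hhm.mk h with hh'
  have hm' : Measurable h' := hhm.stronglyMeasurable_mk.measurable
  have he : h =ᵐ[μ] h' := hhm.ae_eq_mk
  refine ⟨fun x => mz a (f x) - h' x, hMf.sub hm', fun g => ?_, ?_⟩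
  · filter_upwards [hhe g, he, (hτ g).ae he] with x h1 h2 h3
    simp only [TT] at h1 ⊢
    rw [h2, h3] at h1
    linear_combination h1
  · have := (memLp_iff_finI hq hhm).1 hh
    refine this.mono 1 zero_le_one ?_
    filter_upwards [he] with x hx
    rw [one_mul, sub_sub_cancel, hx]

lemma lemHB {p q a : ℝ} (hp : 0 < p) (hpq : p < q) (ha : a = p / q)
    (hd : ∀ g, Measurable (d g)) (hω : ∀ g, Measurable (ω g))
    (hτ : ∀ g, Measure.QuasiMeasurePreserving (τ g) μ μ)
    (hd0 : ∀ g, ∀ᵐ x ∂μ, 0 < d g x) (hω1 : ∀ g, ∀ᵐ x ∂μ, ‖ω g x‖ = 1)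
    (Hq : ∀ f : X → ℂ, Measurable f →
      (∀ g, MemLp (fun x => TT d ω τ q g f x - f x) (ENNReal.ofReal q) μ) →
      ∃ h : X → ℂ, MemLp h (ENNReal.ofReal q) μ ∧
        ∀ g, (fun x => TT d ω τ q g f x - f x) =ᵐ[μ] fun x => TT d ω τ q g h x - h x)
    {k : X → ℂ} (hk : Measurable k) (hkinv : ∀ g, ∀ᵐ x ∂μ, TT d ω τ p g k x = k x)
    (v : X → ℝ) (hv : Measurable v)
    (hdv : ∀ g, FinI μ (fun x => ‖k x‖ ^ p * |v (τ g x) - v x| ^ p)) :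
    ∃ c : X → ℝ, Measurable c ∧ (∀ g, ∀ᵐ x ∂μ, c (τ g x) = c x) ∧
        FinI μ (fun x => ‖k x‖ ^ p * |sp a (v x) - c x| ^ q) := by
  have hq : 0 < q := hp.trans hpq
  have ha0 : 0 < a := by rw [ha]; positivity
  have haq : a * q = p := by rw [ha]; field_simp
  have hpa : p⁻¹ * a = q⁻¹ := by rw [ha]; field_simp
  obtain ⟨F, hFm, hFinv, hFF⟩ := lemA hp hpq ha hd hω hτ hd0 hω1 Hq
    (f := fun x => k x * (v x : ℂ)) (by fun_prop) (by
      intro g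
      refine (hdv g).mono 1 zero_le_one ?_
      filter_upwards [hkinv g] with x hx
      have : TT d ω τ p g (fun x => k x * (v x : ℂ)) x - k x * (v x : ℂ)
          = k x * ((v (τ g x) - v x : ℝ) : ℂ) := by
        simp only [TT] at hx ⊢
        push_cast
        linear_combination (v (τ g x) : ℂ) * hx
      rw [this, norm_mul, Complex.norm_real, Real.norm_eq_abs,
        Real.mul_rpow (norm_nonneg _) (abs_nonneg _), one_mul])
  have hmk : Measurable fun x => mz a (k x) := (mz_measurable a).comp hk
  refine ⟨fun x => (F x / mz a (k x)).re, by fun_prop, fun g => ?_, ?_⟩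
  · filter_upwards [hFinv g, hkinv g, hd0 g, hω1 g] with x h1 h2 h3 h4
    have h5 : TT d ω τ q g (fun y => mz a (k y)) x = mz a (k x) := by
      rw [← mz_TT hpa h3 h4, h2]
    have h6 : ((d g x ^ q⁻¹ : ℝ) : ℂ) * ω g x ≠ 0 := by
      refine mul_ne_zero ?_ ?_
      · rw [Complex.ofReal_ne_zero]; positivity
      · rw [← norm_pos_iff, h4]; exact one_pos
    rw [← h1, ← h5]
    simp only [TT]
    rw [mul_div_mul_left _ _ h6]
  · refine hFF.mono 1 zero_le_one (ae_of_all _ fun x => ?_)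
    rw [one_mul]
    by_cases hx : k x = 0
    · rw [hx, norm_zero, Real.zero_rpow hp.ne', zero_mul]; positivity
    have h0 : mz a (k x) ≠ 0 := by
      rw [← norm_pos_iff, norm_mz ha0]
      have := norm_pos_iff.2 hx
      positivity
    have e : mz a (k x * (v x : ℂ)) - F x = mz a (k x) * ((sp a (v x) : ℂ) - F x / mz a (k x)) := by
      rw [mz_mul, mz_ofReal]; field_simp
    rw [e, norm_mul, Real.mul_rpow (norm_nonneg _) (norm_nonneg _), norm_mz ha0,
      ← Real.rpow_mul (norm_nonneg _), haq]
    have h1 := Complex.abs_re_le_norm ((sp a (v x) : ℂ) - F x / mz a (k x))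
    rw [Complex.sub_re, Complex.ofReal_re] at h1
    gcongr

lemma lemMain {p q : ℝ} (hp : 0 < p) (hpq : p < q)
    (hd : ∀ g, Measurable (d g)) (hω : ∀ g, Measurable (ω g))
    (hτ : ∀ g, Measure.QuasiMeasurePreserving (τ g) μ μ)
    (hd0 : ∀ g, ∀ᵐ x ∂μ, 0 < d g x) (hω1 : ∀ g, ∀ᵐ x ∂μ, ‖ω g x‖ = 1)
    (Hq : ∀ f : X → ℂ, Measurable f →
      (∀ g, MemLp (fun x => TT d ω τ q g f x - f x) (ENNReal.ofReal q) μ) →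
      ∃ h : X → ℂ, MemLp h (ENNReal.ofReal q) μ ∧
        ∀ g, (fun x => TT d ω τ q g f x - f x) =ᵐ[μ] fun x => TT d ω τ q g h x - h x)
    (f : X → ℂ) (hf : Measurable f)
    (hfp : ∀ g, MemLp (fun x => TT d ω τ p g f x - f x) (ENNReal.ofReal p) μ) :
    ∃ h : X → ℂ, MemLp h (ENNReal.ofReal p) μ ∧
      ∀ g, (fun x => TT d ω τ p g f x - f x) =ᵐ[μ] fun x => TT d ω τ p g h x - h x := by
  have hq : 0 < q := hp.trans hpq
  obtain ⟨a, ha⟩ : ∃ a, a = p / q := ⟨_, rfl⟩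
  have ha0 : 0 < a := by rw [ha]; positivity
  have ha1 : a < 1 := by rw [ha, div_lt_one hq]; exact hpq
  have haq : a * q = p := by rw [ha]; field_simp
  have hpa : q⁻¹ * a⁻¹ = p⁻¹ := by rw [ha]; field_simp
  have hb1 : 1 ≤ a⁻¹ := (one_le_inv₀ ha0).2 ha1.le
  have hab : a * a⁻¹ = 1 := mul_inv_cancel₀ ha0.ne'
  have hF : ∀ g, FinI μ (fun x => ‖TT d ω τ p g f x - f x‖ ^ p) := fun g =>
    (memLp_iff_finI hp (hfp g).1).1 (hfp g)
  obtain ⟨F, hFm, hFinv, hFF⟩ := lemA hp hpq ha hd hω hτ hd0 hω1 Hq hf hF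
  obtain ⟨k, hkdef⟩ : ∃ k : X → ℂ, k = fun x => mz a⁻¹ (F x) := ⟨_, rfl⟩
  have hk : Measurable k := by rw [hkdef]; exact (mz_measurable _).comp hFm
  have hkinv : ∀ g, ∀ᵐ x ∂μ, TT d ω τ p g k x = k x := by
    intro g
    filter_upwards [hFinv g, hd0 g, hω1 g] with x h1 h2 h3
    rw [hkdef, ← mz_TT hpa h2 h3, h1]
  have hFk : ∀ x, F x = mz a (k x) := fun x => by
    rw [hkdef]; exact (mz_mz (by positivity) (by rw [mul_comm]; exact hab) _).symm
  obtain ⟨C, hC0, hC⟩ := mz_near_one ha0 hb1 hab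
  have habs : Measurable fun t : ℝ => |t| := measurable_norm
  obtain ⟨u, hudef⟩ : ∃ u : X → ℂ, u = fun x => f x / k x - 1 := ⟨_, rfl⟩
  have hu : Measurable u := by rw [hudef]; fun_prop
  -- general real linear functional
  have main : ∀ L : ℂ → ℝ, Measurable L → (∀ z w, |L z - L w| ≤ ‖z - w‖) → L 0 = 0 →
      ∃ K : X → ℝ, Measurable K ∧ (∀ g, ∀ᵐ x ∂μ, K (τ g x) = K x) ∧
        FinI μ (fun x => ‖k x‖ ^ p * |L (u x) - K x| ^ p) := by
    intro L hLm hL hL0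
    refine lemB hp hpq ha (by fun_prop) (fun x => by positivity)
      (lemHB hp hpq ha hd hω hτ hd0 hω1 Hq hk hkinv) (hLm.comp hu) ?_ ?_
    · intro g
      refine (hF g).mono 1 zero_le_one ?_
      filter_upwards [hkinv g, hd0 g, hω1 g] with x h1 h2 h3
      rw [one_mul]
      by_cases hx : k x = 0
      · rw [hx, norm_zero, Real.zero_rpow hp.ne', zero_mul]; positivity
      have hx' : k (τ g x) ≠ 0 := by
        intro h; apply hx; rw [← h1]; simp [TT, h]
      have e : TT d ω τ p g f x - f x = k x * (u (τ g x) - u x) := by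
        simp only [TT, hudef] at h1 ⊢
        rw [sub_sub_sub_cancel_right, mul_sub, mul_div_cancel₀ _ hx]
        congr 1
        rw [← h1]
        field_simp
      rw [e, norm_mul, Real.mul_rpow (norm_nonneg _) (norm_nonneg _)]
      have := hL (u (τ g x)) (u x)
      gcongr
    · refine hFF.mono (C ^ q) (by positivity) (ae_of_all _ fun x => ?_)
      by_cases hx : k x = 0
      · rw [hx, norm_zero, Real.zero_rpow hp.ne', zero_mul]; positivity
      have e : mz a (f x) - F x = mz a (k x) * (mz a (f x / k x) - 1) := by
        rw [hFk, mul_sub, ← mz_mul, mul_div_cancel₀ _ hx, mul_one]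
      rw [e, norm_mul, Real.mul_rpow (norm_nonneg _) (norm_nonneg _), norm_mz ha0,
        ← Real.rpow_mul (norm_nonneg _), haq]
      have h1 : |L (u x)| ≤ ‖u x‖ := by simpa [hL0] using hL (u x) 0
      have h2 : min |L (u x)| 1 ≤ C * ‖mz a (f x / k x) - 1‖ :=
        (min_le_min_right 1 h1).trans (by rw [hudef]; exact hC _)
      calc ‖k x‖ ^ p * min |(L ∘ u) x| 1 ^ q
          ≤ ‖k x‖ ^ p * (C * ‖mz a (f x / k x) - 1‖) ^ q := by
            simp only [Function.comp]; gcongr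
        _ = _ := by rw [Real.mul_rpow hC0.le (norm_nonneg _)]; ring
  obtain ⟨K1, hK1m, hK1inv, hK1F⟩ := main Complex.re Complex.measurable_re
    (fun z w => by rw [← Complex.sub_re]; exact Complex.abs_re_le_norm _) Complex.zero_re
  obtain ⟨K2, hK2m, hK2inv, hK2F⟩ := main Complex.im Complex.measurable_im
    (fun z w => by rw [← Complex.sub_im]; exact Complex.abs_im_le_norm _) Complex.zero_im
  obtain ⟨Z, hZdef⟩ : ∃ Z : X → ℂ, Z = fun x => 1 + (K1 x : ℂ) + (K2 x : ℂ) * Complex.I :=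
    ⟨_, rfl⟩
  have hZm : Measurable Z := by rw [hZdef]; fun_prop
  have hhm : Measurable fun x => f x - k x * Z x := by fun_prop
  refine ⟨fun x => f x - k x * Z x, ?_, fun g => ?_⟩
  · rw [memLp_iff_finI hp hhm.aestronglyMeasurable]
    have m1 : Measurable fun x => ‖mz a (f x) - F x‖ ^ q := by
      have := (mz_measurable a).comp hf
      simp only [Function.comp_def] at this
      fun_prop
    have m2 : Measurable fun x => ‖k x‖ ^ p * |(u x).re - K1 x| ^ p := by fun_prop
    refine (hFF.add (hK1F.add hK2F m2) m1).mono (2 ^ p) (by positivity)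
      (ae_of_all _ fun x => ?_)
    have h2p : (1 : ℝ) ≤ 2 ^ p := Real.one_le_rpow (by norm_num) hp.le
    have t1 : 0 ≤ ‖mz a (f x) - F x‖ ^ q := by positivity
    have t2 : 0 ≤ ‖k x‖ ^ p * |(u x).re - K1 x| ^ p := by positivity
    have t3 : 0 ≤ ‖k x‖ ^ p * |(u x).im - K2 x| ^ p := by positivity
    by_cases hx : k x = 0
    · have e : ‖f x - k x * Z x‖ ^ p = ‖mz a (f x) - F x‖ ^ q := by
        rw [hFk, hx, mz_zero, zero_mul, sub_zero, sub_zero, norm_mz ha0,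
          ← Real.rpow_mul (norm_nonneg _), haq]
      rw [e]
      nlinarith
    · have e : f x - k x * Z x = k x * (((u x).re - K1 x : ℝ) + ((u x).im - K2 x : ℝ) * Complex.I) := by
        have h1 : f x = k x * (1 + u x) := by rw [hudef]; field_simp; ring
        have h2 := Complex.re_add_im (u x)
        rw [h1, hZdef]
        push_cast
        linear_combination -k x * h2
      have h3 : ‖(((u x).re - K1 x : ℝ) : ℂ) + ((u x).im - K2 x : ℝ) * Complex.I‖
          ≤ |(u x).re - K1 x| + |(u x).im - K2 x| := by
        refine (norm_add_le _ _).trans ?_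
        rw [norm_mul, Complex.norm_I, mul_one, Complex.norm_real, Complex.norm_real]
        rfl
      rw [e, norm_mul, Real.mul_rpow (norm_nonneg _) (norm_nonneg _)]
      calc _ ≤ ‖k x‖ ^ p * (|(u x).re - K1 x| + |(u x).im - K2 x|) ^ p := by gcongr
        _ ≤ ‖k x‖ ^ p * (2 ^ p * (|(u x).re - K1 x| ^ p + |(u x).im - K2 x| ^ p)) := by
            gcongr
            exact rpow_add_le_two hp (abs_nonneg _) (abs_nonneg _)
        _ = 2 ^ p * (‖k x‖ ^ p * |(u x).re - K1 x| ^ p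
              + ‖k x‖ ^ p * |(u x).im - K2 x| ^ p) := by ring
        _ ≤ _ := mul_le_mul_of_nonneg_left (by linarith) (by positivity)
  · filter_upwards [hkinv g, hK1inv g, hK2inv g] with x h1 h2 h3
    have h4 : Z (τ g x) = Z x := by rw [hZdef]; simp only [h2, h3]
    simp only [TT] at h1 ⊢
    rw [h4]
    linear_combination Z x * h1

end Abstract


/-- **Theorem (monotonicity of vanishing of formal coboundaries).** Let `1 ≤ p < q < ∞`,
let `G` be a group, `(X,μ)` a standard σ-finite measure space, `θ` a nonsingular action
of `G` on `(X,μ)` and `ω` a `𝕋`-valued cocycle for `θ`.  If every formal coboundary in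
`L_q` for the representation `π^q` is a genuine coboundary, then every formal coboundary
in `L_p` for `π^p` is a genuine coboundary. -/
theorem stmt14 {G : Type*} [Group G]
    {X : Type*} [MeasurableSpace X] [StandardBorelSpace X]
    (μ : Measure X) [SigmaFinite μ]
    {p q : ℝ} (hp : 1 ≤ p) (hpq : p < q)
    (θ : G → X → X) (hθ_meas : ∀ g, Measurable (θ g))
    (hθ_ns : ∀ g, μ.map (θ g) ≪ μ ∧ μ ≪ μ.map (θ g))
    (hθ_one : θ 1 =ᵐ[μ] id)
    (hθ_mul : ∀ g h : G, θ (g * h) =ᵐ[μ] (θ g) ∘ (θ h))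
    (ω : G → X → ℂ) (hω_meas : ∀ g, Measurable (ω g))
    (hω_circ : ∀ g, ∀ᵐ x ∂μ, ‖ω g x‖ = 1)
    (hω_cocycle : ∀ g h : G, ω (g * h) =ᵐ[μ] fun x => ω g x * ω h (θ g⁻¹ x))
    (Hq : ∀ f : X → ℂ, Measurable f →
      (∀ g : G, MemLp (fun x => piRep μ θ ω q g f x - f x) (ENNReal.ofReal q) μ) →
      ∃ h : X → ℂ, MemLp h (ENNReal.ofReal q) μ ∧
        ∀ g : G, (fun x => piRep μ θ ω q g f x - f x)
          =ᵐ[μ] fun x => piRep μ θ ω q g h x - h x) :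
    ∀ f : X → ℂ, Measurable f →
      (∀ g : G, MemLp (fun x => piRep μ θ ω p g f x - f x) (ENNReal.ofReal p) μ) →
      ∃ h : X → ℂ, MemLp h (ENNReal.ofReal p) μ ∧
        ∀ g : G, (fun x => piRep μ θ ω p g f x - f x)
          =ᵐ[μ] fun x => piRep μ θ ω p g h x - h x := by
  have hτ : ∀ g, Measure.QuasiMeasurePreserving (θ g) μ μ := fun g =>
    ⟨hθ_meas g, (hθ_ns g).1⟩
  have hinv : ∀ g, ∀ᵐ x ∂μ, θ g⁻¹ (θ g x) = x := by
    intro g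
    have h1 := hθ_mul g⁻¹ g
    rw [inv_mul_cancel] at h1
    filter_upwards [h1, hθ_one] with x h2 h3
    rw [h3] at h2
    exact h2.symm
  have hσ : ∀ g, SigmaFinite (μ.map (θ g)) := by
    intro g
    refine ⟨⟨⟨fun n => θ g⁻¹ ⁻¹' (toMeasurable μ (spanningSets μ n)), fun _ => trivial,
      fun n => ?_, ?_⟩⟩⟩
    · rw [Measure.map_apply (hθ_meas g) (hθ_meas _ (measurableSet_toMeasurable _ _))]
      have : (θ g ⁻¹' (θ g⁻¹ ⁻¹' (toMeasurable μ (spanningSets μ n))) : Set X)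
          =ᵐ[μ] (toMeasurable μ (spanningSets μ n) : Set X) := by
        filter_upwards [hinv g] with x hx
        change (θ g⁻¹ (θ g x) ∈ toMeasurable μ (spanningSets μ n))
          = (x ∈ toMeasurable μ (spanningSets μ n))
        rw [hx]
      rw [measure_congr this, measure_toMeasurable]
      exact measure_spanningSets_lt_top μ n
    · rw [Set.eq_univ_iff_forall]
      intro x
      have hx : θ g⁻¹ x ∈ ⋃ n, spanningSets μ n := by rw [iUnion_spanningSets]; trivial
      obtain ⟨n, hn⟩ := Set.mem_iUnion.1 hx
      exact Set.mem_iUnion.2 ⟨n, subset_toMeasurable _ _ hn⟩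
  have hd0 : ∀ g, ∀ᵐ x ∂μ, 0 < ((μ.map (θ g)).rnDeriv μ x).toReal := by
    intro g
    have := hσ g
    filter_upwards [Measure.rnDeriv_pos' (hθ_ns g).2, Measure.rnDeriv_ne_top (μ.map (θ g)) μ]
      with x h1 h2
    exact ENNReal.toReal_pos h1.ne' h2
  exact fun f hf hfp => lemMain (d := fun g x => ((μ.map (θ g)).rnDeriv μ x).toReal) (ω := ω)
    (τ := fun g => θ g⁻¹) (by linarith) hpq
    (fun g => (Measure.measurable_rnDeriv _ _).ennreal_toReal) hω_meas
    (fun g => hτ g⁻¹) hd0 hω_circ Hq f hf hfp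
end
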